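/- arXiv:2602.14142 — 6 statements merged into one kernel-verified Lean document; each statement's English description precedes it below -/
import Mathlib

section
/- The total mass of the invariant density of the Reverse algorithm equals one: the iterated integral ∫₀¹ ∫₀^{1−x} 4/(π²·(1−x)·(1−y)·(x+y)) dy dx equals 1. -/
open MeasureTheory

lemma hasSum_one_div_odd_sq :
    HasSum (fun n : ℕ => 1 / (2 * (n : ℝ) + 1) ^ 2) (Real.pi ^ 2 / 8) := by
  have h := hasSum_zeta_two
  have he : HasSum (fun n : ℕ => 1 / ((2 * n : ℕ) : ℝ) ^ 2) (1 / 4 * (Real.pi ^ 2 / 6)) := by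
    have hn (n : ℕ) : 1 / ((2 * n : ℕ) : ℝ) ^ 2 = 1 / 4 * (1 / (n : ℝ) ^ 2) := by
      push_cast
      rw [mul_pow, div_mul_div_comm]
      norm_num
    simpa only [hn] using h.mul_left (1 / 4)
  have ho : Summable (fun n : ℕ => 1 / ((2 * n + 1 : ℕ) : ℝ) ^ 2) :=
    h.summable.comp_injective (i := fun n : ℕ => 2 * n + 1) fun a b hab => by
      simp only at hab
      omega
  have hs := (HasSum.even_add_odd (f := fun n : ℕ => 1 / (n : ℝ) ^ 2) he ho.hasSum).unique h
  have hval : ∑' n : ℕ, 1 / ((2 * n + 1 : ℕ) : ℝ) ^ 2 = Real.pi ^ 2 / 8 := by linarith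
  rw [← hval]
  exact_mod_cast ho.hasSum

lemma intervalIntegrable_pow_mul_log (m : ℕ) :
    IntervalIntegrable (fun x : ℝ => x ^ m * Real.log x) volume 0 1 :=
  intervalIntegral.intervalIntegrable_log'.continuousOn_mul (by fun_prop)

lemma integral_pow_mul_log (m : ℕ) :
    ∫ x in (0 : ℝ)..1, x ^ m * Real.log x = -(1 / ((m : ℝ) + 1) ^ 2) := by
  have hm : (m : ℝ) + 1 ≠ 0 := by positivity
  have hcont : ContinuousOn (fun x : ℝ => x ^ m * (x * Real.log x) / ((m : ℝ) + 1)
      - x ^ (m + 1) / ((m : ℝ) + 1) ^ 2) (Set.Icc 0 1) :=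
    ((((continuous_pow m).mul Real.continuous_mul_log).div_const _).sub
      ((continuous_pow (m + 1)).div_const _)).continuousOn
  rw [intervalIntegral.integral_eq_sub_of_hasDerivAt_of_le zero_le_one hcont ?_
    (intervalIntegrable_pow_mul_log m)]
  · simp
  · intro x hx
    have hx0 : x ≠ 0 := hx.1.ne'
    have h := (((hasDerivAt_pow (m + 1) x).mul (Real.hasDerivAt_log hx0)).div_const
      ((m : ℝ) + 1)).sub ((hasDerivAt_pow (m + 1) x).div_const (((m : ℝ) + 1) ^ 2))
    convert h using 1
    · ext y
      simp only [Pi.sub_apply, Pi.mul_apply]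
      ring
    · push_cast
      field_simp
      ring

lemma integral_neg_log_div_one_sub_sq :
    ∫ x in Set.Ioo (0 : ℝ) 1, -Real.log x / (1 - x ^ 2) = Real.pi ^ 2 / 8 := by
  have hterm (n : ℕ) : ∫ x in Set.Ioo (0 : ℝ) 1, -(x ^ (2 * n) * Real.log x)
      = 1 / (2 * (n : ℝ) + 1) ^ 2 := by
    rw [integral_neg, ← integral_Ioc_eq_integral_Ioo, ← intervalIntegral.integral_of_le zero_le_one,
      integral_pow_mul_log]
    simp
  have hnn (n : ℕ) : ∀ x ∈ Set.Ioo (0 : ℝ) 1, 0 ≤ -(x ^ (2 * n) * Real.log x) := fun x hx => by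
    have := mul_nonpos_of_nonneg_of_nonpos (pow_nonneg hx.1.le (2 * n))
      (Real.log_nonpos hx.1.le hx.2.le)
    linarith
  have h := hasSum_integral_of_summable_integral_norm
    (μ := volume.restrict (Set.Ioo (0 : ℝ) 1)) (F := fun (n : ℕ) x => -(x ^ (2 * n) * Real.log x))
    (fun n => ((intervalIntegrable_iff_integrableOn_Ioo_of_le zero_le_one).1
      (intervalIntegrable_pow_mul_log (2 * n))).neg)
    (by
      refine hasSum_one_div_odd_sq.summable.congr fun n => ?_
      rw [← hterm n]
      refine setIntegral_congr_fun measurableSet_Ioo fun x hx => ?_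
      exact (Real.norm_of_nonneg (hnn n x hx)).symm)
  simp only [hterm] at h
  rw [← h.unique hasSum_one_div_odd_sq]
  refine setIntegral_congr_fun measurableSet_Ioo fun x hx => ?_
  have hx2 : x ^ 2 < 1 := pow_lt_one₀ hx.1.le hx.2 two_ne_zero
  have hg := (hasSum_geometric_of_lt_one (sq_nonneg x) hx2).mul_left (-Real.log x)
  rw [div_eq_mul_inv, ← hg.tsum_eq]
  refine tsum_congr fun n => ?_
  rw [pow_mul]
  ring

lemma integral_inv_one_sub_mul_add {x : ℝ} (hx : x ∈ Set.Ioo (0 : ℝ) 1) :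
    ∫ y in Set.Ioo (0 : ℝ) (1 - x), 1 / ((1 - y) * (x + y)) = -2 * Real.log x / (1 + x) := by
  obtain ⟨h0, h1⟩ := hx
  have hle : (0 : ℝ) ≤ 1 - x := by linarith
  rw [← integral_Ioc_eq_integral_Ioo, ← intervalIntegral.integral_of_le hle]
  have hne : ∀ y ∈ Set.uIcc 0 (1 - x), 1 - y ≠ 0 ∧ x + y ≠ 0 := fun y hy => by
    rw [Set.uIcc_of_le hle] at hy
    exact ⟨by linarith [hy.2], by linarith [hy.1]⟩
  rw [intervalIntegral.integral_eq_sub_of_hasDerivAt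
    (f := fun y => (Real.log (x + y) - Real.log (1 - y)) / (1 + x))]
  · simp
    ring
  · intro y hy
    obtain ⟨ha, hb⟩ := hne y hy
    have h := ((((hasDerivAt_id y).const_add x).log hb).sub
      (((hasDerivAt_id y).const_sub 1).log ha)).div_const (1 + x)
    refine h.congr_deriv ?_
    have : 1 + x ≠ 0 := by linarith
    simp only [id]
    field_simp
    ring
  · refine ContinuousOn.intervalIntegrable (ContinuousOn.div (by fun_prop) (by fun_prop) ?_)
    exact fun y hy => mul_ne_zero (hne y hy).1 (hne y hy).2

/-- The total mass of the invariant density of the Reverse algorithm equals one. -/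
theorem reverse_density_total_mass :
    (∫ x in Set.Ioo (0:ℝ) 1, ∫ y in Set.Ioo (0:ℝ) (1 - x),
      4 / (Real.pi ^ 2 * (1 - x) * (1 - y) * (x + y))) = 1 := by
  have h : ∀ x ∈ Set.Ioo (0 : ℝ) 1, ∫ y in Set.Ioo (0:ℝ) (1 - x),
      4 / (Real.pi ^ 2 * (1 - x) * (1 - y) * (x + y))
      = 8 / Real.pi ^ 2 * (-Real.log x / (1 - x ^ 2)) := fun x hx => by
    have hfac (y : ℝ) : 4 / (Real.pi ^ 2 * (1 - x) * (1 - y) * (x + y))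
        = 4 / (Real.pi ^ 2 * (1 - x)) * (1 / ((1 - y) * (x + y))) := by
      rw [div_mul_div_comm, mul_one, ← mul_assoc]
    simp only [hfac]
    rw [integral_const_mul, integral_inv_one_sub_mul_add hx, div_mul_div_comm, div_mul_div_comm]
    congr 1 <;> ring
  rw [setIntegral_congr_fun measurableSet_Ioo h, integral_const_mul,
    integral_neg_log_div_one_sub_sq]
  field_simp
end

section
/- The Reverse algorithm is ergodic with respect to μ: the map f_R preserves the measure μ, and every Borel set E ⊆ Δ̄ with f_R⁻¹(E) = E satisfies μ(E) = 0 or μ(Δ̄ \ E) = 0. -/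
open MeasureTheory Matrix

noncomputable section

/-- The four matrices of the Reverse algorithm. -/
def M1 : Matrix (Fin 3) (Fin 3) ℝ := !![1,1,1; 0,1,0; 0,0,1]
def M2 : Matrix (Fin 3) (Fin 3) ℝ := !![1,0,0; 1,1,1; 0,0,1]
def M3 : Matrix (Fin 3) (Fin 3) ℝ := !![1,0,0; 0,1,0; 1,1,1]
def M4 : Matrix (Fin 3) (Fin 3) ℝ := !![0,1,1; 1,0,1; 1,1,0]

def Mat : Fin 4 → Matrix (Fin 3) (Fin 3) ℝ := ![M1, M2, M3, M4]

/-- The closed standard 2-simplex in ℝ³. -/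
def simplexBar : Set (Fin 3 → ℝ) := {x | (∀ i, 0 ≤ x i) ∧ x 0 + x 1 + x 2 = 1}

/-- The open standard 2-simplex in ℝ³. -/
def simplexOpen : Set (Fin 3 → ℝ) := {x | (∀ i, 0 < x i) ∧ x 0 + x 1 + x 2 = 1}

/-- The projectivized Reverse algorithm map. -/
def fR (x : Fin 3 → ℝ) : Fin 3 → ℝ :=
  if 1 < 2 * x 0 then ![(x 0 - x 1 - x 2) / x 0, x 1 / x 0, x 2 / x 0]
  else if 1 < 2 * x 1 then ![x 0 / x 1, (-x 0 + x 1 - x 2) / x 1, x 2 / x 1]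
  else if 1 < 2 * x 2 then ![x 0 / x 2, x 1 / x 2, (-x 0 - x 1 + x 2) / x 2]
  else ![-x 0 + x 1 + x 2, x 0 - x 1 + x 2, x 0 + x 1 - x 2]

/-- The digit `a(x)` of a point: the index of the cell `Δ(a(x))` containing `x`. -/
def digit (x : Fin 3 → ℝ) : Fin 4 :=
  if 1 < 2 * x 0 then 0 else if 1 < 2 * x 1 then 1 else if 1 < 2 * x 2 then 2 else 3

/-- The cocycle `A^{(n)}(x) = ᵗM_{a(f^{n-1}x)} ⋯ ᵗM_{a(fx)} ᵗM_{a(x)}`. -/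
def Acoc : ℕ → (Fin 3 → ℝ) → Matrix (Fin 3) (Fin 3) ℝ
  | 0, _ => 1
  | n+1, x => Acoc n (fR x) * (Mat (digit x))ᵀ

/-- The invariant measure μ of the Reverse algorithm: in coordinates (x₁,x₂) it has
density 4/(π²(x₁+x₂)(1-x₁)(1-x₂)) on the open triangle. -/
def muR : Measure (Fin 3 → ℝ) :=
  Measure.map (fun p : ℝ × ℝ => ![1 - p.1 - p.2, p.1, p.2])
    (((volume : Measure (ℝ × ℝ)).restrict
        {p : ℝ × ℝ | 0 < p.1 ∧ 0 < p.2 ∧ p.1 + p.2 < 1}).withDensity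
      (fun p => ENNReal.ofReal (4 / (Real.pi ^ 2 * (p.1 + p.2) * (1 - p.1) * (1 - p.2)))))

/-- The sum of the coordinates of a vector in `ℝ³`. -/
def coordSum (x : Fin 3 → ℝ) : ℝ := x 0 + x 1 + x 2

/-- The inverse branch of `fR` on the cell with index `i`. -/
def branch (i : Fin 4) (y : Fin 3 → ℝ) : Fin 3 → ℝ :=
  (coordSum (Mat i *ᵥ y))⁻¹ • (Mat i *ᵥ y)

lemma Mat_mulVec (i : Fin 4) (y : Fin 3 → ℝ) :
    Mat i *ᵥ y = ![![y 0 + y 1 + y 2, y 1, y 2], ![y 0, y 0 + y 1 + y 2, y 2],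
      ![y 0, y 1, y 0 + y 1 + y 2], ![y 1 + y 2, y 0 + y 2, y 0 + y 1]] i := by
  ext j
  fin_cases i <;> fin_cases j <;>
    simp [Mat, M1, M2, M3, M4, Matrix.mulVec, dotProduct, Fin.sum_univ_three]

lemma coordSum_Mat_mulVec_pos (i : Fin 4) {y : Fin 3 → ℝ} (hy : y ∈ simplexBar) :
    0 < coordSum (Mat i *ᵥ y) := by
  obtain ⟨h, hs⟩ := hy
  have h0 := h 0; have h1 := h 1; have h2 := h 2
  rw [Mat_mulVec]
  fin_cases i <;> simp [coordSum] <;> linarith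

lemma simplexOpen_subset_simplexBar : simplexOpen ⊆ simplexBar :=
  fun _ hx => ⟨fun i => (hx.1 i).le, hx.2⟩

lemma branch_mem_simplexOpen (i : Fin 4) {y : Fin 3 → ℝ} (hy : y ∈ simplexOpen) :
    branch i y ∈ simplexOpen := by
  have hp := coordSum_Mat_mulVec_pos i (simplexOpen_subset_simplexBar hy)
  refine ⟨fun j => ?_, ?_⟩
  · refine mul_pos (inv_pos.2 hp) ?_
    obtain ⟨h, hs⟩ := hy
    have h0 := h 0; have h1 := h 1; have h2 := h 2
    rw [Mat_mulVec]
    fin_cases i <;> fin_cases j <;> simp <;> linarith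
  · simp only [branch, Pi.smul_apply, smul_eq_mul, ← mul_add]
    exact inv_mul_cancel₀ hp.ne'

lemma digit_branch (i : Fin 4) {y : Fin 3 → ℝ} (hy : y ∈ simplexOpen) :
    digit (branch i y) = i := by
  have hp := coordSum_Mat_mulVec_pos i (simplexOpen_subset_simplexBar hy)
  obtain ⟨h, hs⟩ := hy
  have h0 := h 0; have h1 := h 1; have h2 := h 2
  have key : ∀ j, 1 < 2 * branch i y j ↔
      coordSum (Mat i *ᵥ y) < 2 * (Mat i *ᵥ y) j := by
    intro j
    simp only [branch, Pi.smul_apply, smul_eq_mul]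
    rw [← div_eq_inv_mul, mul_div_assoc', lt_div_iff₀ hp, one_mul]
  simp only [digit, key, Mat_mulVec, coordSum]
  fin_cases i <;> simp <;> grind

lemma fR_mem_simplexBar {x : Fin 3 → ℝ} (hx : x ∈ simplexBar) : fR x ∈ simplexBar := by
  obtain ⟨h, hs⟩ := hx
  have h0 := h 0; have h1 := h 1; have h2 := h 2
  unfold fR
  split_ifs with c0 c1 c2
  · have : 0 < x 0 := by linarith
    refine ⟨fun j => ?_, ?_⟩
    · fin_cases j <;> simp <;> apply div_nonneg <;> linarith
    · simp; field_simp; ring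
  · have : 0 < x 1 := by linarith
    refine ⟨fun j => ?_, ?_⟩
    · fin_cases j <;> simp <;> apply div_nonneg <;> linarith
    · simp; field_simp; ring
  · have : 0 < x 2 := by linarith
    refine ⟨fun j => ?_, ?_⟩
    · fin_cases j <;> simp <;> apply div_nonneg <;> linarith
    · simp; field_simp; ring
  · refine ⟨fun j => ?_, ?_⟩
    · fin_cases j <;> simp <;> linarith
    · simp; linarith

lemma fR_mem_simplexOpen {x : Fin 3 → ℝ} (hx : x ∈ simplexOpen) (hne : ∀ j, 2 * x j ≠ 1) :
    fR x ∈ simplexOpen := by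
  refine ⟨?_, (fR_mem_simplexBar (simplexOpen_subset_simplexBar hx)).2⟩
  obtain ⟨h, hs⟩ := hx
  have h0 := h 0; have h1 := h 1; have h2 := h 2
  unfold fR
  split_ifs with c0 c1 c2
  · intro j
    fin_cases j <;> simp <;> apply div_pos <;> linarith
  · intro j
    fin_cases j <;> simp <;> apply div_pos <;> linarith
  · intro j
    fin_cases j <;> simp <;> apply div_pos <;> linarith
  · have c0' := lt_of_le_of_ne (not_lt.1 c0) (hne 0)
    have c1' := lt_of_le_of_ne (not_lt.1 c1) (hne 1)
    have c2' := lt_of_le_of_ne (not_lt.1 c2) (hne 2)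
    intro j
    fin_cases j <;> simp <;> linarith

lemma Mat_digit_mulVec_fR {x : Fin 3 → ℝ} (hx : x ∈ simplexBar) :
    ∃ c : ℝ, 0 < c ∧ Mat (digit x) *ᵥ fR x = c • x := by
  obtain ⟨h, hs⟩ := hx
  have h0 := h 0; have h1 := h 1; have h2 := h 2
  rw [Mat_mulVec]
  unfold fR digit
  split_ifs with c0 c1 c2
  · have : 0 < x 0 := by linarith
    refine ⟨(x 0)⁻¹, by positivity, ?_⟩
    ext j; fin_cases j <;> simp <;> field_simp; ring
  · have : 0 < x 1 := by linarith
    refine ⟨(x 1)⁻¹, by positivity, ?_⟩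
    ext j; fin_cases j <;> simp <;> field_simp; ring
  · have : 0 < x 2 := by linarith
    refine ⟨(x 2)⁻¹, by positivity, ?_⟩
    ext j; fin_cases j <;> simp <;> field_simp; ring
  · refine ⟨2, by norm_num, ?_⟩
    ext j; fin_cases j <;> simp <;> ring

lemma branch_digit_fR {x : Fin 3 → ℝ} (hx : x ∈ simplexBar) :
    branch (digit x) (fR x) = x := by
  obtain ⟨c, hc, h⟩ := Mat_digit_mulVec_fR hx
  have hs : coordSum (c • x) = c := by
    simp only [coordSum, Pi.smul_apply, smul_eq_mul, ← mul_add, hx.2, mul_one]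
  rw [branch, h, hs, smul_smul, inv_mul_cancel₀ hc.ne', one_smul]

lemma det_Mat (i : Fin 4) : (Mat i).det = ![1, 1, 1, 2] i := by
  fin_cases i <;> simp [Mat, M1, M2, M3, M4, Matrix.det_fin_three]
  norm_num

lemma det_Mat_pos (i : Fin 4) : 0 < (Mat i).det := by
  rw [det_Mat]
  fin_cases i <;> simp

lemma fR_branch (i : Fin 4) {y : Fin 3 → ℝ} (hy : y ∈ simplexOpen) :
    fR (branch i y) = y := by
  have hz := simplexOpen_subset_simplexBar (branch_mem_simplexOpen i hy)
  obtain ⟨c, -, h⟩ := Mat_digit_mulVec_fR hz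
  rw [digit_branch i hy, branch, smul_smul, ← branch, ← Matrix.mulVec_smul] at h
  have hinj : Function.Injective (Mat i).mulVec :=
    Matrix.mulVec_injective_of_isUnit
      ((Matrix.isUnit_iff_isUnit_det _).2 (det_Mat_pos i).ne'.isUnit)
  have h' := hinj h
  have hs := (fR_mem_simplexBar hz).2
  rw [h'] at hs ⊢
  simp only [Pi.smul_apply, smul_eq_mul, ← mul_add, hy.2, mul_one] at hs
  rw [hs, one_smul]

/-- The open triangle parametrizing the simplex. -/
def triangle : Set (ℝ × ℝ) := {p | 0 < p.1 ∧ 0 < p.2 ∧ p.1 + p.2 < 1}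

/-- The affine parametrization of the plane `x₀ + x₁ + x₂ = 1`. -/
def emb (p : ℝ × ℝ) : Fin 3 → ℝ := ![1 - p.1 - p.2, p.1, p.2]

/-- Lebesgue measure on the simplex. -/
def lam : Measure (Fin 3 → ℝ) := Measure.map emb (volume.restrict triangle)

lemma measurable_emb : Measurable emb := by
  refine measurable_pi_iff.2 fun j => ?_
  fin_cases j <;> simp [emb] <;> fun_prop

lemma measurableSet_triangle : MeasurableSet triangle := by
  have h1 : IsOpen {p : ℝ × ℝ | 0 < p.1} := isOpen_lt continuous_const continuous_fst
  have h2 : IsOpen {p : ℝ × ℝ | 0 < p.2} := isOpen_lt continuous_const continuous_snd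
  have h3 : IsOpen {p : ℝ × ℝ | p.1 + p.2 < 1} :=
    isOpen_lt (continuous_fst.add continuous_snd) continuous_const
  exact (h1.inter (h2.inter h3)).measurableSet

lemma emb_mem_simplexOpen {p : ℝ × ℝ} : emb p ∈ simplexOpen ↔ p ∈ triangle := by
  constructor
  · rintro ⟨h, -⟩
    have h0 := h 0; have h1 := h 1; have h2 := h 2
    simp [emb] at h0 h1 h2
    exact ⟨h1, h2, by linarith⟩
  · rintro ⟨h1, h2, h3⟩
    refine ⟨fun j => ?_, by simp [emb]; ring⟩
    fin_cases j <;> simp [emb] <;> linarith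

lemma emb_injective : Function.Injective emb := by
  intro p q h
  have h1 := congrFun h 1
  have h2 := congrFun h 2
  exact Prod.ext h1 h2

lemma emb_coords {x : Fin 3 → ℝ} (hx : x 0 + x 1 + x 2 = 1) : emb (x 1, x 2) = x := by
  ext j
  fin_cases j <;> simp [emb]
  linarith

lemma measurableSet_simplexOpen : MeasurableSet simplexOpen := by
  have : simplexOpen = (⋂ i : Fin 3, {x | 0 < x i}) ∩ {x | x 0 + x 1 + x 2 = 1} := by
    ext x; simp [simplexOpen]
  rw [this]
  refine (MeasurableSet.iInter fun i => ?_).inter ?_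
  · exact measurableSet_lt measurable_const (measurable_pi_apply i)
  · exact measurableSet_eq_fun (by fun_prop) measurable_const

lemma measurableSet_simplexBar : MeasurableSet simplexBar := by
  have : simplexBar = (⋂ i : Fin 3, {x | 0 ≤ x i}) ∩ {x | x 0 + x 1 + x 2 = 1} := by
    ext x; simp [simplexBar]
  rw [this]
  refine (MeasurableSet.iInter fun i => ?_).inter ?_
  · exact measurableSet_le measurable_const (measurable_pi_apply i)
  · exact measurableSet_eq_fun (by fun_prop) measurable_const

lemma measurableSet_one_lt (j : Fin 3) : MeasurableSet {x : Fin 3 → ℝ | 1 < 2 * x j} :=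
  measurableSet_lt measurable_const (by fun_prop)

lemma measurable_digit : Measurable digit := by
  unfold digit
  exact Measurable.ite (measurableSet_one_lt 0) measurable_const
    (Measurable.ite (measurableSet_one_lt 1) measurable_const
      (Measurable.ite (measurableSet_one_lt 2) measurable_const measurable_const))

lemma measurable_fR : Measurable fR := by
  unfold fR
  refine Measurable.ite (measurableSet_one_lt 0) ?_
    (Measurable.ite (measurableSet_one_lt 1) ?_
      (Measurable.ite (measurableSet_one_lt 2) ?_ ?_)) <;>
  · refine measurable_pi_iff.2 fun j => ?_
    fin_cases j <;> simp <;> fun_prop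

lemma measurableSet_digit (i : Fin 4) : MeasurableSet {x | digit x = i} :=
  measurable_digit (measurableSet_singleton i)

lemma measurable_branch (i : Fin 4) : Measurable (branch i) := by
  refine measurable_pi_iff.2 fun j => ?_
  simp only [branch, coordSum, Matrix.mulVec, dotProduct, Fin.sum_univ_three, Pi.smul_apply,
    smul_eq_mul]
  fun_prop

lemma ae_lam_mem_simplexOpen : ∀ᵐ x ∂lam, x ∈ simplexOpen := by
  refine (ae_map_iff measurable_emb.aemeasurable measurableSet_simplexOpen).2 ?_
  filter_upwards [ae_restrict_mem measurableSet_triangle] with p hp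
  exact emb_mem_simplexOpen.2 hp

lemma ae_lam_mem_simplexBar : ∀ᵐ x ∂lam, x ∈ simplexBar :=
  ae_lam_mem_simplexOpen.mono fun _ hx => simplexOpen_subset_simplexBar hx

lemma volume_two_mul_emb_eq_one (j : Fin 3) :
    (volume : Measure (ℝ × ℝ)) {p | 2 * emb p j = 1} = 0 := by
  have hm : MeasurableSet {p | 2 * emb p j = 1} :=
    measurableSet_eq_fun (((measurable_pi_apply j).comp measurable_emb).const_mul 2)
      measurable_const
  rw [Measure.volume_eq_prod]
  by_cases hj : j = 1
  · subst hj
    have : {p : ℝ × ℝ | 2 * emb p 1 = 1} = {1 / 2} ×ˢ Set.univ := by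
      ext p
      simp [emb]
      constructor <;> intro h <;> linarith
    rw [this, Measure.prod_prod]
    simp
  · rw [Measure.measure_prod_null hm]
    refine Filter.Eventually.of_forall fun a => ?_
    refine Set.Subsingleton.measure_zero (fun b hb c hc => ?_) _
    simp only [Set.mem_preimage, Set.mem_ofPred_eq] at hb hc
    fin_cases j <;> simp [emb] at hb hc hj <;> linarith

/-- The projective action of a matrix, in the chart given by `emb`. -/
def projMap (M : Matrix (Fin 3) (Fin 3) ℝ) (p : ℝ × ℝ) : ℝ × ℝ :=
  ((M *ᵥ emb p) 1 / coordSum (M *ᵥ emb p), (M *ᵥ emb p) 2 / coordSum (M *ᵥ emb p))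

lemma mulVec_emb (M : Matrix (Fin 3) (Fin 3) ℝ) (p : ℝ × ℝ) (j : Fin 3) :
    (M *ᵥ emb p) j = M j 0 + (M j 1 - M j 0) * p.1 + (M j 2 - M j 0) * p.2 := by
  simp [emb, Matrix.mulVec, dotProduct, Fin.sum_univ_three]
  ring

lemma exists_hasFDerivAt_projMap (M : Matrix (Fin 3) (Fin 3) ℝ) (p : ℝ × ℝ)
    (hp : coordSum (M *ᵥ emb p) ≠ 0) :
    ∃ f' : ℝ × ℝ →L[ℝ] ℝ × ℝ, HasFDerivAt (projMap M) f' p ∧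
      f'.det = M.det / coordSum (M *ᵥ emb p) ^ 3 := by
  have hN : ∀ j, HasFDerivAt (fun p => (M *ᵥ emb p) j)
      ((M j 1 - M j 0) • ContinuousLinearMap.fst ℝ ℝ ℝ +
        (M j 2 - M j 0) • ContinuousLinearMap.snd ℝ ℝ ℝ) p := by
    intro j
    simp only [mulVec_emb]
    exact ((hasFDerivAt_fst.const_mul _).const_add _).add (hasFDerivAt_snd.const_mul _)
  have hS : HasFDerivAt (fun p => coordSum (M *ᵥ emb p)) _ p := ((hN 0).add (hN 1)).add (hN 2)
  have hI := (hasDerivAt_inv hp).comp_hasFDerivAt p hS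
  have hD := ((hN 1).mul hI).prodMk ((hN 2).mul hI)
  set L := coordSum (M *ᵥ emb p) with hL
  set S1 := (M 0 1 - M 0 0) + (M 1 1 - M 1 0) + (M 2 1 - M 2 0) with hS1
  set S2 := (M 0 2 - M 0 0) + (M 1 2 - M 1 0) + (M 2 2 - M 2 0) with hS2
  refine ⟨(Matrix.toLin (.finTwoProd ℝ) (.finTwoProd ℝ)
    !![(L * (M 1 1 - M 1 0) - (M *ᵥ emb p) 1 * S1) / L ^ 2,
       (L * (M 1 2 - M 1 0) - (M *ᵥ emb p) 1 * S2) / L ^ 2;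
       (L * (M 2 1 - M 2 0) - (M *ᵥ emb p) 2 * S1) / L ^ 2,
       (L * (M 2 2 - M 2 0) - (M *ᵥ emb p) 2 * S2) / L ^ 2]).toContinuousLinearMap, ?_, ?_⟩
  · rw [Matrix.toLin_finTwoProd_toContinuousLinearMap]
    have hproj : projMap M = fun p => ((M *ᵥ emb p) 1 * (coordSum (M *ᵥ emb p))⁻¹,
        (M *ᵥ emb p) 2 * (coordSum (M *ᵥ emb p))⁻¹) := by
      ext q <;> simp [projMap, div_eq_mul_inv]
    rw [hproj]
    refine HasFDerivAt.congr_fderiv hD ?_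
    ext <;> simp [← hL] <;> field_simp <;> simp only [hS1, hS2] <;> ring
  · rw [LinearMap.det_toContinuousLinearMap, LinearMap.det_toLin, Matrix.det_fin_two_of,
      Matrix.det_fin_three]
    have hL' : L = (M *ᵥ emb p) 0 + (M *ᵥ emb p) 1 + (M *ᵥ emb p) 2 := rfl
    field_simp
    rw [hS1, hS2, hL', mulVec_emb, mulVec_emb, mulVec_emb]
    ring

lemma emb_projMap_Mat (i : Fin 4) {p : ℝ × ℝ} (hp : p ∈ triangle) :
    emb (projMap (Mat i) p) = branch i (emb p) := by
  have hb := branch_mem_simplexOpen i (emb_mem_simplexOpen.2 hp)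
  rw [← emb_coords hb.2]
  simp [projMap, branch, div_eq_inv_mul]

lemma injOn_projMap_Mat (i : Fin 4) : Set.InjOn (projMap (Mat i)) triangle := by
  intro p hp q hq h
  have h' := congrArg (fun r => fR (emb r)) h
  simp only [emb_projMap_Mat i hp, emb_projMap_Mat i hq] at h'
  rw [fR_branch i (emb_mem_simplexOpen.2 hp), fR_branch i (emb_mem_simplexOpen.2 hq)] at h'
  exact emb_injective h'

lemma image_projMap_Mat_ae_eq (i : Fin 4) :
    (emb ⁻¹' {x | digit x = i} ∩ triangle : Set (ℝ × ℝ)) =ᵐ[volume]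
      projMap (Mat i) '' triangle := by
  have hae : ∀ᵐ p : ℝ × ℝ, ∀ j, 2 * emb p j ≠ 1 := by
    rw [ae_all_iff]
    intro j
    exact measure_eq_zero_iff_ae_notMem.1 (volume_two_mul_emb_eq_one j)
  filter_upwards [hae] with p hp
  refine propext ⟨?_, ?_⟩
  · rintro ⟨hd, ht⟩
    have ho := emb_mem_simplexOpen.2 ht
    have hf := fR_mem_simplexOpen ho hp
    have hq : (fR (emb p) 1, fR (emb p) 2) ∈ triangle := by
      rw [← emb_mem_simplexOpen, emb_coords hf.2]
      exact hf
    refine ⟨_, hq, emb_injective ?_⟩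
    rw [emb_projMap_Mat i hq, emb_coords hf.2]
    rw [← (hd : digit (emb p) = i)]
    exact branch_digit_fR (simplexOpen_subset_simplexBar ho)
  · rintro ⟨q, hq, rfl⟩
    have hq' := emb_mem_simplexOpen.2 hq
    refine ⟨?_, ?_⟩
    · change digit _ = i
      rw [emb_projMap_Mat i hq, digit_branch i hq']
    · rw [← emb_mem_simplexOpen, emb_projMap_Mat i hq]
      exact branch_mem_simplexOpen i hq'

lemma measurable_coordSum_mulVec (M : Matrix (Fin 3) (Fin 3) ℝ) :
    Measurable fun y : Fin 3 → ℝ => coordSum (M *ᵥ y) := by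
  simp only [coordSum, Matrix.mulVec, dotProduct, Fin.sum_univ_three]
  fun_prop

/-- Change of variables along an inverse branch of `fR`. -/
lemma setLIntegral_digit_eq (i : Fin 4) {F : (Fin 3 → ℝ) → ENNReal} (hF : Measurable F) :
    ∫⁻ x in {x | digit x = i}, F x ∂lam =
      ∫⁻ y, ENNReal.ofReal ((Mat i).det / coordSum (Mat i *ᵥ y) ^ 3) * F (branch i y) ∂lam := by
  have hm : Measurable fun y => ENNReal.ofReal ((Mat i).det / coordSum (Mat i *ᵥ y) ^ 3) *
      F (branch i y) :=
    ((measurable_const.div ((measurable_coordSum_mulVec _).pow_const 3)).ennreal_ofReal).mul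
      (hF.comp (measurable_branch i))
  have hpos : ∀ p ∈ triangle, 0 < coordSum (Mat i *ᵥ emb p) := fun p hp =>
    coordSum_Mat_mulVec_pos i (simplexOpen_subset_simplexBar (emb_mem_simplexOpen.2 hp))
  have hex : ∀ p, ∃ f' : ℝ × ℝ →L[ℝ] ℝ × ℝ, p ∈ triangle → HasFDerivAt (projMap (Mat i)) f' p ∧
      f'.det = (Mat i).det / coordSum (Mat i *ᵥ emb p) ^ 3 := by
    intro p
    by_cases hp : p ∈ triangle
    · obtain ⟨f', h⟩ := exists_hasFDerivAt_projMap (Mat i) p (hpos p hp).ne'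
      exact ⟨f', fun _ => h⟩
    · exact ⟨0, fun h => absurd h hp⟩
  choose f' hf' using hex
  rw [lam, setLIntegral_map (measurableSet_digit i) hF measurable_emb,
    lintegral_map hm measurable_emb,
    Measure.restrict_restrict (measurable_emb (measurableSet_digit i)),
    setLIntegral_congr (image_projMap_Mat_ae_eq i),
    lintegral_image_eq_lintegral_abs_det_fderiv_mul volume measurableSet_triangle
      (fun p hp => (hf' p hp).1.hasFDerivWithinAt) (injOn_projMap_Mat i)]
  refine setLIntegral_congr_fun measurableSet_triangle fun p hp => ?_
  rw [(hf' p hp).2, emb_projMap_Mat i hp,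
    abs_of_pos (div_pos (det_Mat_pos i) (pow_pos (hpos p hp) 3))]

/-- The invariant density, up to normalization. -/
def density (x : Fin 3 → ℝ) : ENNReal :=
  ENNReal.ofReal (4 / (Real.pi ^ 2 * (x 1 + x 2) * (1 - x 1) * (1 - x 2)))

lemma measurable_density : Measurable density := by
  unfold density
  fun_prop

lemma muR_eq_withDensity : muR = lam.withDensity density := by
  ext s hs
  have he : MeasurableSet (emb ⁻¹' s) := measurable_emb hs
  rw [withDensity_apply _ hs, lam, setLIntegral_map hs measurable_density measurable_emb]
  change Measure.map emb _ s = _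
  rw [Measure.map_apply measurable_emb hs, withDensity_apply _ he]
  rfl

lemma sum_density_branch {y : Fin 3 → ℝ} (hy : y ∈ simplexOpen) :
    ∑ i, ENNReal.ofReal ((Mat i).det / coordSum (Mat i *ᵥ y) ^ 3) * density (branch i y) =
      density y := by
  obtain ⟨h, hs⟩ := hy
  have h0 := h 0; have h1 := h 1; have h2 := h 2
  have hp := fun i => coordSum_Mat_mulVec_pos i (simplexOpen_subset_simplexBar ⟨h, hs⟩)
  have hm : ∀ i, ENNReal.ofReal ((Mat i).det / coordSum (Mat i *ᵥ y) ^ 3) *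
      density (branch i y) = ENNReal.ofReal (((Mat i).det / coordSum (Mat i *ᵥ y) ^ 3) *
        (4 / (Real.pi ^ 2 * (branch i y 1 + branch i y 2) * (1 - branch i y 1) *
          (1 - branch i y 2)))) := fun i => by
    rw [density, ← ENNReal.ofReal_mul (div_pos (det_Mat_pos i) (pow_pos (hp i) 3)).le]
  have hnn : ∀ i ∈ Finset.univ, 0 ≤ ((Mat i).det / coordSum (Mat i *ᵥ y) ^ 3) *
        (4 / (Real.pi ^ 2 * (branch i y 1 + branch i y 2) * (1 - branch i y 1) *
          (1 - branch i y 2))) := fun i _ => by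
    obtain ⟨hb, hbs⟩ := branch_mem_simplexOpen i ⟨h, hs⟩
    have hb0 := hb 0; have hb1 := hb 1; have hb2 := hb 2
    have e1 : 0 < 1 - branch i y 1 := by linarith
    have e2 : 0 < 1 - branch i y 2 := by linarith
    have := hp i
    have := det_Mat_pos i
    positivity
  simp only [hm]
  rw [← ENNReal.ofReal_sum_of_nonneg hnn, density]
  congr 1
  have hb : ∀ i j, branch i y j = (Mat i *ᵥ y) j / coordSum (Mat i *ᵥ y) := fun i j => by
    simp [branch, div_eq_inv_mul]
  have e : y 0 = 1 - y 1 - y 2 := by linarith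
  have q1 : 0 < 1 - y 1 := by linarith
  have q2 : 0 < 1 - y 2 := by linarith
  have p0 : 0 < 1 + y 1 + y 2 := by linarith
  have p1 : 0 < 2 - y 1 := by linarith
  have p2 : 0 < 2 - y 2 := by linarith
  have p3 : 0 < y 1 + y 2 := by linarith
  have hterm : ∀ i, ((Mat i).det / coordSum (Mat i *ᵥ y) ^ 3) *
        (4 / (Real.pi ^ 2 * (branch i y 1 + branch i y 2) * (1 - branch i y 1) *
          (1 - branch i y 2))) = (Mat i).det * (4 / (Real.pi ^ 2 *
        (((Mat i *ᵥ y) 1 + (Mat i *ᵥ y) 2) * ((Mat i *ᵥ y) 0 + (Mat i *ᵥ y) 2) *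
          ((Mat i *ᵥ y) 0 + (Mat i *ᵥ y) 1)))) := fun i => by
    have hS := (hp i).ne'
    have t1 : 1 - branch i y 1 = ((Mat i *ᵥ y) 0 + (Mat i *ᵥ y) 2) / coordSum (Mat i *ᵥ y) := by
      rw [hb, eq_div_iff hS, sub_mul, div_mul_cancel₀ _ hS, coordSum]; ring
    have t2 : 1 - branch i y 2 = ((Mat i *ᵥ y) 0 + (Mat i *ᵥ y) 1) / coordSum (Mat i *ᵥ y) := by
      rw [hb, eq_div_iff hS, sub_mul, div_mul_cancel₀ _ hS, coordSum]; ring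
    rw [t1, t2, hb, hb, ← add_div]
    field_simp
  rw [Finset.sum_congr rfl fun i _ => hterm i]
  simp only [det_Mat, Fin.sum_univ_four, Mat_mulVec]
  have r2 : 1 - y 1 - y 2 + y 1 = 1 - y 2 := by ring
  have r3 : 1 - y 1 - y 2 + y 2 = 1 - y 1 := by ring
  have r6 : 1 - y 1 - y 2 + 1 = 2 - y 1 - y 2 := by ring
  have r7 : 1 - y 1 + (1 - y 2) = 2 - y 1 - y 2 := by ring
  have q3 : 0 < 1 + y 1 := by linarith
  have q4 : 0 < 1 + y 2 := by linarith
  have q5 : 0 < 2 - y 1 - y 2 := by linarith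
  have r10 : y 1 + y 2 + (1 - y 2) = 1 + y 1 := by ring
  have r11 : y 1 + y 2 + (1 - y 1) = 1 + y 2 := by ring
  have r12 : y 1 + 1 = 1 + y 1 := by ring
  simp [e, r2, r3, r6, r7, r10, r11, r12]
  field_simp
  ring

lemma lintegral_eq_sum_setLIntegral_digit (μ : Measure (Fin 3 → ℝ)) (F : (Fin 3 → ℝ) → ENNReal) :
    ∫⁻ x, F x ∂μ = ∑ i, ∫⁻ x in {x | digit x = i}, F x ∂μ := by
  have hU : (⋃ i, {x | digit x = i}) = Set.univ := by
    ext x; simp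
  rw [← setLIntegral_univ, ← hU, lintegral_iUnion measurableSet_digit, tsum_fintype]
  intro i j hij
  exact Set.disjoint_left.2 fun x hx hx' => hij (hx.symm.trans hx')

lemma setLIntegral_digit_comp_fR (i : Fin 4) {ρ G : (Fin 3 → ℝ) → ENNReal} (hρ : Measurable ρ)
    (hG : Measurable G) :
    ∫⁻ x in {x | digit x = i}, ρ x * G (fR x) ∂lam =
      ∫⁻ y, ENNReal.ofReal ((Mat i).det / coordSum (Mat i *ᵥ y) ^ 3) * ρ (branch i y) * G y
        ∂lam := by
  refine (setLIntegral_digit_eq i (hρ.mul (hG.comp measurable_fR))).trans ?_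
  refine lintegral_congr_ae ?_
  filter_upwards [ae_lam_mem_simplexOpen] with y hy
  simp only [Pi.mul_apply, Function.comp_apply, fR_branch i hy, mul_assoc]

lemma measurePreserving_fR : MeasurePreserving fR muR muR := by
  refine ⟨measurable_fR, ?_⟩
  ext s hs
  have h1 : Measurable (s.indicator (1 : (Fin 3 → ℝ) → ENNReal)) := measurable_one.indicator hs
  have hf : MeasurableSet (fR ⁻¹' s) := measurable_fR hs
  have hJ : ∀ i, Measurable fun y => ENNReal.ofReal ((Mat i).det / coordSum (Mat i *ᵥ y) ^ 3) *
      density (branch i y) * s.indicator 1 y := fun i =>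
    (((measurable_const.div ((measurable_coordSum_mulVec _).pow_const 3)).ennreal_ofReal).mul
      (measurable_density.comp (measurable_branch i))).mul h1
  have key : ∀ t, MeasurableSet t → ∫⁻ x in t, density x ∂lam =
      ∫⁻ x, density x * t.indicator 1 x ∂lam := fun t ht => by
    rw [← lintegral_indicator ht]
    refine lintegral_congr fun x => ?_
    by_cases hx : x ∈ t <;> simp [hx]
  rw [Measure.map_apply measurable_fR hs, muR_eq_withDensity, withDensity_apply _ hs,
    withDensity_apply _ hf, key _ hs, key _ hf, lintegral_eq_sum_setLIntegral_digit]
  have : ∀ x, (fR ⁻¹' s).indicator (1 : (Fin 3 → ℝ) → ENNReal) x = s.indicator 1 (fR x) :=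
    fun x => rfl
  simp only [this, setLIntegral_digit_comp_fR _ measurable_density h1]
  rw [← lintegral_finsetSum _ fun i _ => hJ i]
  refine lintegral_congr_ae ?_
  filter_upwards [ae_lam_mem_simplexOpen] with y hy
  rw [← Finset.sum_mul, sum_density_branch hy]

lemma triangle_subset : triangle ⊆ Set.Ioo 0 1 ×ˢ Set.Ioo 0 1 := by
  rintro p ⟨h1, h2, h3⟩
  exact ⟨⟨h1, by linarith⟩, ⟨h2, by linarith⟩⟩

lemma lam_univ_le_one : lam Set.univ ≤ 1 := by
  rw [lam, Measure.map_apply measurable_emb MeasurableSet.univ, Set.preimage_univ,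
    Measure.restrict_apply_univ]
  refine (measure_mono triangle_subset).trans ?_
  rw [Measure.volume_eq_prod, Measure.prod_prod]
  simp

instance : IsFiniteMeasure lam := ⟨lam_univ_le_one.trans_lt ENNReal.one_lt_top⟩

lemma inv_le_rpow_mul_rpow {u v w : ℝ} (hu : 0 < u) (hv : 0 < v) (huw : u ≤ w) (hvw : v ≤ w) :
    w⁻¹ ≤ u ^ (-(1 / 2) : ℝ) * v ^ (-(1 / 2) : ℝ) := by
  have hw : 0 < w := hu.trans_le huw
  calc w⁻¹ = w ^ (-(1 / 2) : ℝ) * w ^ (-(1 / 2) : ℝ) := by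
        rw [← Real.rpow_add hw, ← Real.rpow_neg_one]; norm_num
    _ ≤ _ := mul_le_mul (Real.rpow_le_rpow_of_nonpos hu huw (by norm_num))
        (Real.rpow_le_rpow_of_nonpos hv hvw (by norm_num)) (by positivity) (by positivity)

lemma density_bound {p : ℝ × ℝ} (hp : p ∈ triangle) :
    4 / (Real.pi ^ 2 * (p.1 + p.2) * (1 - p.1) * (1 - p.2)) ≤
      p.1 ^ (-(1 / 2) : ℝ) * p.2 ^ (-(1 / 2) : ℝ) +
      (1 - p.1) ^ (-(1 / 2) : ℝ) * p.2 ^ (-(1 / 2) : ℝ) +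
      p.1 ^ (-(1 / 2) : ℝ) * (1 - p.2) ^ (-(1 / 2) : ℝ) := by
  obtain ⟨h1, h2, h3⟩ := hp
  have a1 := inv_le_rpow_mul_rpow h1 h2 (by linarith : p.1 ≤ p.1 + p.2) (by linarith)
  have q1 : 0 < 1 - p.1 := by linarith
  have q2 : 0 < 1 - p.2 := by linarith
  have q3 : 0 < p.1 + p.2 := by linarith
  have a2 := inv_le_rpow_mul_rpow q1 h2 le_rfl (by linarith)
  have a3 := inv_le_rpow_mul_rpow h1 q2 (by linarith) le_rfl
  refine le_trans ?_ (add_le_add (add_le_add a1 a2) a3)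
  have hpi : 4 ≤ Real.pi ^ 2 := by nlinarith [Real.two_le_pi]
  calc 4 / (Real.pi ^ 2 * (p.1 + p.2) * (1 - p.1) * (1 - p.2))
      ≤ Real.pi ^ 2 / (Real.pi ^ 2 * (p.1 + p.2) * (1 - p.1) * (1 - p.2)) := by gcongr
    _ = 1 / ((p.1 + p.2) * (1 - p.1) * (1 - p.2)) := by
        have := Real.pi_pos
        field_simp
    _ ≤ ((1 - p.1) * (1 - p.2) + (p.1 + p.2) * (1 - p.2) + (p.1 + p.2) * (1 - p.1)) /
          ((p.1 + p.2) * (1 - p.1) * (1 - p.2)) := by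
        gcongr
        nlinarith [mul_pos h1 h2, mul_pos h1 (sub_pos.2 h3), mul_pos h2 (sub_pos.2 h3)]
    _ = _ := by field_simp

lemma isFiniteMeasure_muR : IsFiniteMeasure muR := by
  constructor
  have i1 : IntegrableOn (fun x : ℝ => x ^ (-(1 / 2) : ℝ)) (Set.Ioo 0 1) :=
    (intervalIntegrable_iff_integrableOn_Ioo_of_le zero_le_one).1
      (intervalIntegral.intervalIntegrable_rpow' (by norm_num))
  have i2 : IntegrableOn (fun x : ℝ => (1 - x) ^ (-(1 / 2) : ℝ)) (Set.Ioo 0 1) := by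
    have : IntervalIntegrable (fun x : ℝ => x ^ (-(1 / 2) : ℝ)) volume 0 1 :=
      intervalIntegral.intervalIntegrable_rpow' (by norm_num)
    have h := (this.comp_sub_left 1).symm
    simp only [sub_zero, sub_self] at h
    exact (intervalIntegrable_iff_integrableOn_Ioo_of_le zero_le_one).1 h
  have hK := ((i1.integrable.mul_prod i1.integrable).add (i2.integrable.mul_prod i1.integrable)).add
    (i1.integrable.mul_prod i2.integrable)
  rw [Measure.prod_restrict, ← Measure.volume_eq_prod] at hK
  have hK' := hK.mono_measure (Measure.restrict_mono triangle_subset le_rfl)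
  rw [muR_eq_withDensity, withDensity_apply _ MeasurableSet.univ, setLIntegral_univ, lam,
    lintegral_map measurable_density measurable_emb]
  refine lt_of_le_of_lt ?_ hK'.lintegral_lt_top
  refine setLIntegral_mono' measurableSet_triangle fun p hp => ?_
  exact ENNReal.ofReal_le_ofReal (density_bound hp)

lemma muR_absolutelyContinuous_lam : muR ≪ lam := by
  rw [muR_eq_withDensity]
  exact withDensity_absolutelyContinuous _ _

lemma lam_absolutelyContinuous_muR : lam ≪ muR := by
  rw [muR_eq_withDensity]
  refine withDensity_absolutelyContinuous' measurable_density.aemeasurable ?_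
  filter_upwards [ae_lam_mem_simplexOpen] with x hx
  obtain ⟨h, hs⟩ := hx
  have h0 := h 0; have h1 := h 1; have h2 := h 2
  have e1 : 0 < 1 - x 1 := by linarith
  have e2 : 0 < 1 - x 2 := by linarith
  have := Real.pi_pos
  exact (ENNReal.ofReal_pos.2 (by positivity)).ne'

/-- The first `n` digits of `x`, the most recent one first. -/
def word : ℕ → (Fin 3 → ℝ) → List (Fin 4)
  | 0, _ => []
  | n + 1, x => digit (fR^[n] x) :: word n x

/-- The product of matrices attached to a word, whose head is the rightmost factor. -/
def wordMat : List (Fin 4) → Matrix (Fin 3) (Fin 3) ℝ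
  | [] => 1
  | i :: w => wordMat w * Mat i

/-- The cylinder of points whose expansion starts with a given word. -/
def wordCylinder (w : List (Fin 4)) : Set (Fin 3 → ℝ) := {x | word w.length x = w}

lemma length_word (n : ℕ) (x : Fin 3 → ℝ) : (word n x).length = n := by
  induction n with
  | zero => rfl
  | succ n ih => simp [word, ih]

lemma mem_wordCylinder_word (n : ℕ) (x : Fin 3 → ℝ) : x ∈ wordCylinder (word n x) := by
  simp only [wordCylinder, Set.mem_ofPred_eq, length_word]

lemma wordCylinder_cons (i : Fin 4) (w : List (Fin 4)) :
    wordCylinder (i :: w) = wordCylinder w ∩ {x | digit (fR^[w.length] x) = i} := by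
  ext x
  simp [wordCylinder, word, and_comm]

lemma measurable_iterate_fR (n : ℕ) : Measurable fR^[n] := measurable_fR.iterate n

lemma measurableSet_wordCylinder (w : List (Fin 4)) : MeasurableSet (wordCylinder w) := by
  induction w with
  | nil => simp [wordCylinder, word]
  | cons i w ih =>
    rw [wordCylinder_cons]
    exact ih.inter (measurable_iterate_fR _ (measurableSet_digit i))

lemma iterate_fR_mem_simplexBar {x : Fin 3 → ℝ} (hx : x ∈ simplexBar) (n : ℕ) :
    fR^[n] x ∈ simplexBar := by
  induction n with
  | zero => exact hx
  | succ n ih =>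
    rw [Function.iterate_succ_apply']
    exact fR_mem_simplexBar ih

lemma coordSum_add (x y : Fin 3 → ℝ) : coordSum (x + y) = coordSum x + coordSum y := by
  simp only [coordSum, Pi.add_apply]; ring

lemma coordSum_smul (c : ℝ) (x : Fin 3 → ℝ) : coordSum (c • x) = c * coordSum x := by
  simp only [coordSum, Pi.smul_apply, smul_eq_mul]; ring

lemma Mat_mulVec_nonneg (i : Fin 4) {y : Fin 3 → ℝ} (hy : 0 ≤ y) : 0 ≤ Mat i *ᵥ y := by
  have h0 : 0 ≤ y 0 := hy 0
  have h1 : 0 ≤ y 1 := hy 1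
  have h2 : 0 ≤ y 2 := hy 2
  rw [Mat_mulVec]
  intro j
  fin_cases i <;> fin_cases j <;> simp <;> linarith

lemma coordSum_le_coordSum_Mat_mulVec (i : Fin 4) {y : Fin 3 → ℝ} (hy : 0 ≤ y) :
    coordSum y ≤ coordSum (Mat i *ᵥ y) := by
  have h0 : 0 ≤ y 0 := hy 0
  have h1 : 0 ≤ y 1 := hy 1
  have h2 : 0 ≤ y 2 := hy 2
  rw [Mat_mulVec]
  fin_cases i <;> simp [coordSum] <;> linarith

lemma wordMat_cons_mulVec (i : Fin 4) (w : List (Fin 4)) (y : Fin 3 → ℝ) :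
    wordMat (i :: w) *ᵥ y = wordMat w *ᵥ (Mat i *ᵥ y) := by
  rw [wordMat, Matrix.mulVec_mulVec]

lemma wordMat_mulVec_nonneg (w : List (Fin 4)) {y : Fin 3 → ℝ} (hy : 0 ≤ y) :
    0 ≤ wordMat w *ᵥ y := by
  induction w generalizing y with
  | nil => simpa [wordMat] using hy
  | cons i w ih =>
    rw [wordMat_cons_mulVec]
    exact ih (Mat_mulVec_nonneg i hy)

lemma coordSum_le_coordSum_wordMat_mulVec (w : List (Fin 4)) {y : Fin 3 → ℝ} (hy : 0 ≤ y) :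
    coordSum y ≤ coordSum (wordMat w *ᵥ y) := by
  induction w generalizing y with
  | nil => simp [wordMat]
  | cons i w ih =>
    rw [wordMat_cons_mulVec]
    exact (coordSum_le_coordSum_Mat_mulVec i hy).trans (ih (Mat_mulVec_nonneg i hy))

lemma coordSum_nonneg {y : Fin 3 → ℝ} (hy : 0 ≤ y) : 0 ≤ coordSum y :=
  add_nonneg (add_nonneg (hy 0) (hy 1)) (hy 2)

lemma coordSum_wordMat_mulVec_pos (w : List (Fin 4)) {y : Fin 3 → ℝ} (hy : y ∈ simplexBar) :
    0 < coordSum (wordMat w *ᵥ y) := by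
  refine lt_of_lt_of_le ?_ (coordSum_le_coordSum_wordMat_mulVec w hy.1)
  rw [coordSum, hy.2]
  exact one_pos

lemma det_wordMat_pos (w : List (Fin 4)) : 0 < (wordMat w).det := by
  induction w with
  | nil => simp [wordMat]
  | cons i w ih =>
    rw [wordMat, Matrix.det_mul]
    exact mul_pos ih (det_Mat_pos i)

/-- Change of variables along an inverse branch of an iterate of `fR`. -/
lemma setLIntegral_wordCylinder_comp_iterate (w : List (Fin 4)) {F : (Fin 3 → ℝ) → ENNReal}
    (hF : Measurable F) :
    ∫⁻ x in wordCylinder w, F (fR^[w.length] x) ∂lam =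
      ∫⁻ y, ENNReal.ofReal ((wordMat w).det / coordSum (wordMat w *ᵥ y) ^ 3) * F y ∂lam := by
  induction w generalizing F with
  | nil =>
    have : wordCylinder [] = Set.univ := by ext; simp [wordCylinder, word]
    rw [this, setLIntegral_univ]
    refine lintegral_congr_ae ?_
    filter_upwards [ae_lam_mem_simplexBar] with y hy
    simp [wordMat, coordSum, hy.2]
  | cons i w ih =>
    have hG : Measurable ({x | digit x = i}.indicator fun x => F (fR x)) :=
      (hF.comp measurable_fR).indicator (measurableSet_digit i)
    have hρ : Measurable fun y =>
        ENNReal.ofReal ((wordMat w).det / coordSum (wordMat w *ᵥ y) ^ 3) :=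
      (measurable_const.div ((measurable_coordSum_mulVec _).pow_const 3)).ennreal_ofReal
    have hpre : MeasurableSet {x | digit (fR^[w.length] x) = i} :=
      measurable_iterate_fR _ (measurableSet_digit i)
    calc ∫⁻ x in wordCylinder (i :: w), F (fR^[(i :: w).length] x) ∂lam
        = ∫⁻ x in wordCylinder w,
            {x | digit x = i}.indicator (fun x => F (fR x)) (fR^[w.length] x) ∂lam := by
          rw [wordCylinder_cons, Set.inter_comm, ← Measure.restrict_restrict hpre,
            ← lintegral_indicator hpre]
          refine lintegral_congr fun x => ?_
          simp only [List.length_cons, Function.iterate_succ_apply']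
          rfl
      _ = ∫⁻ y in {x | digit x = i},
            ENNReal.ofReal ((wordMat w).det / coordSum (wordMat w *ᵥ y) ^ 3) * F (fR y) ∂lam := by
          rw [ih hG, ← lintegral_indicator (measurableSet_digit i)]
          refine lintegral_congr fun y => ?_
          by_cases hy : digit y = i <;> simp [Set.indicator, hy]
      _ = _ := by
          rw [setLIntegral_digit_comp_fR i hρ hF]
          refine lintegral_congr_ae ?_
          filter_upwards [ae_lam_mem_simplexBar] with y hy
          have hS := coordSum_Mat_mulVec_pos i hy
          have hW := coordSum_wordMat_mulVec_pos (i :: w) hy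
          rw [← ENNReal.ofReal_mul (div_pos (det_Mat_pos i) (pow_pos hS 3)).le, branch,
            Matrix.mulVec_smul, coordSum_smul, ← wordMat_cons_mulVec, wordMat, Matrix.det_mul,
            ← wordMat]
          congr 2
          field_simp

lemma measure_wordCylinder_inter_preimage (w : List (Fin 4)) {A : Set (Fin 3 → ℝ)}
    (hA : MeasurableSet A) :
    lam (wordCylinder w ∩ fR^[w.length] ⁻¹' A) =
      ∫⁻ y in A, ENNReal.ofReal ((wordMat w).det / coordSum (wordMat w *ᵥ y) ^ 3) ∂lam := by
  have hpre : MeasurableSet (fR^[w.length] ⁻¹' A) := measurable_iterate_fR _ hA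
  have h := setLIntegral_wordCylinder_comp_iterate w
    (measurable_one.indicator hA : Measurable (A.indicator (1 : (Fin 3 → ℝ) → ENNReal)))
  rw [← lintegral_indicator hA]
  have e : ∀ x, A.indicator (1 : (Fin 3 → ℝ) → ENNReal) (fR^[w.length] x) =
    (fR^[w.length] ⁻¹' A).indicator 1 x := fun x => rfl
  simp only [e] at h
  rw [lintegral_indicator_one hpre, Measure.restrict_apply hpre, Set.inter_comm] at h
  rw [h]
  refine lintegral_congr fun y => ?_
  by_cases hy : y ∈ A <;> simp [hy]

lemma Mat_three_mulVec_twice (y : Fin 3 → ℝ) :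
    Mat 3 *ᵥ (Mat 3 *ᵥ y) = y + coordSum y • (1 : Fin 3 → ℝ) := by
  rw [Mat_mulVec, Mat_mulVec]
  ext j
  fin_cases j <;> simp [coordSum] <;> ring

lemma wordMat_three_three_mulVec (u : List (Fin 4)) (y : Fin 3 → ℝ) :
    wordMat (3 :: 3 :: u) *ᵥ y = wordMat u *ᵥ y + coordSum y • (wordMat u *ᵥ 1) := by
  rw [wordMat_cons_mulVec, wordMat_cons_mulVec, Mat_three_mulVec_twice, Matrix.mulVec_add,
    Matrix.mulVec_smul]

lemma coordSum_wordMat_mulVec_le (u : List (Fin 4)) {y : Fin 3 → ℝ} (hy : 0 ≤ y) :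
    coordSum (wordMat u *ᵥ y) ≤ coordSum y * coordSum (wordMat u *ᵥ 1) := by
  have h : 0 ≤ coordSum y • (1 : Fin 3 → ℝ) - y := by
    have h0 : 0 ≤ y 0 := hy 0
    have h1 : 0 ≤ y 1 := hy 1
    have h2 : 0 ≤ y 2 := hy 2
    intro j
    fin_cases j <;> simp [coordSum] <;> linarith
  have h' := coordSum_nonneg (wordMat_mulVec_nonneg u h)
  have e : coordSum y • (1 : Fin 3 → ℝ) = (coordSum y • (1 : Fin 3 → ℝ) - y) + y := by simp
  rw [← coordSum_smul, ← Matrix.mulVec_smul, e, Matrix.mulVec_add, coordSum_add]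
  linarith

lemma coordSum_eq_one {y : Fin 3 → ℝ} (hy : y ∈ simplexBar) : coordSum y = 1 := hy.2

/-- Bounded distortion on cylinders that end with the digits `3, 3`. -/
lemma exists_distortion_bound (u : List (Fin 4)) :
    ∃ c : ENNReal, c ≠ 0 ∧ lam (wordCylinder (3 :: 3 :: u)) ≤ 8 * c ∧
      ∀ A : Set (Fin 3 → ℝ), MeasurableSet A → c * lam A ≤
        lam (wordCylinder (3 :: 3 :: u) ∩ fR^[(3 :: 3 :: u).length] ⁻¹' A) := by
  set w := 3 :: 3 :: u with hw
  set D := (wordMat w).det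
  have hD : 0 < D := det_wordMat_pos w
  set L := coordSum (wordMat u *ᵥ 1) with hL
  have hLpos : 0 < L := by
    refine lt_of_lt_of_le ?_ (coordSum_le_coordSum_wordMat_mulVec u zero_le_one)
    norm_num [coordSum]
  have hS : ∀ y ∈ simplexBar, coordSum (wordMat w *ᵥ y) = coordSum (wordMat u *ᵥ y) + L :=
    fun y hy => by
      rw [hw, wordMat_three_three_mulVec, coordSum_add, coordSum_smul, coordSum_eq_one hy, one_mul]
  refine ⟨ENNReal.ofReal (D / (2 * L) ^ 3), ?_, ?_, fun A hA => ?_⟩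
  · rw [ne_eq, ENNReal.ofReal_eq_zero, not_le]
    positivity
  · have h := measure_wordCylinder_inter_preimage w MeasurableSet.univ
    rw [Set.preimage_univ, Set.inter_univ] at h
    rw [h]
    calc _ ≤ ∫⁻ _ in Set.univ, ENNReal.ofReal (D / L ^ 3) ∂lam := by
          refine lintegral_mono_ae ?_
          filter_upwards [ae_restrict_of_ae ae_lam_mem_simplexBar] with y hy
          refine ENNReal.ofReal_le_ofReal (div_le_div_of_nonneg_left hD.le (by positivity) ?_)
          gcongr
          rw [hS y hy]
          linarith [coordSum_wordMat_mulVec_pos u hy]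
      _ ≤ ENNReal.ofReal (D / L ^ 3) := by
          rw [setLIntegral_const]
          exact mul_le_of_le_one_right' lam_univ_le_one
      _ = _ := by
          rw [← ENNReal.ofReal_ofNat 8, ← ENNReal.ofReal_mul (by norm_num)]
          congr 1
          field_simp
          norm_num
  · rw [measure_wordCylinder_inter_preimage w hA, ← setLIntegral_const]
    refine lintegral_mono_ae ?_
    filter_upwards [ae_restrict_of_ae ae_lam_mem_simplexBar] with y hy
    refine ENNReal.ofReal_le_ofReal ?_
    have hle := coordSum_wordMat_mulVec_le u (hy.1 : 0 ≤ y)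
    rw [coordSum_eq_one hy, one_mul] at hle
    have hp := coordSum_wordMat_mulVec_pos w hy
    refine div_le_div_of_nonneg_left hD.le (pow_pos hp 3) ?_
    gcongr
    rw [hS y hy]
    linarith

/-- The set of points from which the digit pair `3, 3` is never read. -/
def neverRecurrent : Set (Fin 3 → ℝ) := {x | ∀ n, fR^[n] x ∉ wordCylinder [3, 3]}

lemma measurableSet_neverRecurrent : MeasurableSet neverRecurrent := by
  have : neverRecurrent = ⋂ n, fR^[n] ⁻¹' (wordCylinder [3, 3])ᶜ := by
    ext x
    simp [neverRecurrent]
  rw [this]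
  exact MeasurableSet.iInter fun n =>
    measurable_iterate_fR n (measurableSet_wordCylinder _).compl

lemma lam_neverRecurrent : lam neverRecurrent = 0 := by
  have hN := measurableSet_neverRecurrent
  have := isFiniteMeasure_muR
  have hsub : neverRecurrent ⊆ fR^[2] ⁻¹' neverRecurrent := fun x hx n => by
    rw [← Function.iterate_add_apply]
    exact hx _
  have hdiff : muR (fR^[2] ⁻¹' neverRecurrent \ neverRecurrent) = 0 := by
    rw [measure_sdiff hsub hN.nullMeasurableSet (measure_ne_top _ _),
      (measurePreserving_fR.iterate 2).measure_preimage hN.nullMeasurableSet, tsub_self]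
  have hnull : lam (wordCylinder [3, 3] ∩ fR^[2] ⁻¹' neverRecurrent) = 0 :=
    lam_absolutelyContinuous_muR
      (measure_mono_null
        (fun x (hx : x ∈ wordCylinder [3, 3] ∩ fR^[2] ⁻¹' neverRecurrent) =>
          (⟨hx.2, fun h => h 0 hx.1⟩ : x ∈ fR^[2] ⁻¹' neverRecurrent \ neverRecurrent)) hdiff)
  obtain ⟨c, hc, -, hle⟩ := exists_distortion_bound []
  have h := hle _ hN
  rw [show ([3, 3] : List (Fin 4)).length = 2 from rfl, hnull, nonpos_iff_eq_zero, mul_eq_zero] at h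
  exact h.resolve_left hc

lemma ae_frequently_mem_wordCylinder :
    ∀ᵐ x ∂lam, ∀ m, ∃ n, m ≤ n ∧ fR^[n] x ∈ wordCylinder [3, 3] := by
  refine ae_all_iff.2 fun m => ?_
  have h : muR (fR^[m] ⁻¹' neverRecurrent) = 0 := by
    rw [(measurePreserving_fR.iterate m).measure_preimage
      measurableSet_neverRecurrent.nullMeasurableSet]
    exact muR_absolutelyContinuous_lam lam_neverRecurrent
  filter_upwards [measure_eq_zero_iff_ae_notMem.1 (lam_absolutelyContinuous_muR h)] with x hx
  simp only [Set.mem_preimage, neverRecurrent, Set.mem_ofPred_eq, not_forall, not_not] at hx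
  obtain ⟨n, hn⟩ := hx
  exact ⟨n + m, Nat.le_add_left m n, by rwa [Function.iterate_add_apply]⟩

/-- The coordinates of the normalized image of the nonnegative cone under `wordMat w` oscillate
by at most `δ`. -/
def OscLE (w : List (Fin 4)) (δ : ℝ) : Prop :=
  ∃ a : Fin 3 → ℝ, ∀ y : Fin 3 → ℝ, 0 ≤ y → ∀ i,
    a i * coordSum (wordMat w *ᵥ y) ≤ (wordMat w *ᵥ y) i ∧
      (wordMat w *ᵥ y) i ≤ (a i + δ) * coordSum (wordMat w *ᵥ y)

lemma oscLE_nil : OscLE [] 1 := by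
  refine ⟨0, fun y hy i => ?_⟩
  have h0 : 0 ≤ y 0 := hy 0
  have h1 : 0 ≤ y 1 := hy 1
  have h2 : 0 ≤ y 2 := hy 2
  fin_cases i <;> simp [wordMat, coordSum] <;> constructor <;> linarith

lemma OscLE.cons {w : List (Fin 4)} {δ : ℝ} (h : OscLE w δ) (i : Fin 4) : OscLE (i :: w) δ := by
  obtain ⟨a, ha⟩ := h
  refine ⟨a, fun y hy => ?_⟩
  rw [wordMat_cons_mulVec]
  exact ha _ (Mat_mulVec_nonneg i hy)

lemma OscLE.three_three {u : List (Fin 4)} {δ : ℝ} (h : OscLE u δ) :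
    OscLE (3 :: 3 :: u) (δ / 2) := by
  obtain ⟨a, ha⟩ := h
  set q := wordMat u *ᵥ 1 with hq
  have hQ : 0 < coordSum q := by
    refine lt_of_lt_of_le ?_ (coordSum_le_coordSum_wordMat_mulVec u zero_le_one)
    norm_num [coordSum]
  refine ⟨fun i => (a i + q i / coordSum q) / 2, fun y hy i => ?_⟩
  obtain ⟨h1, h2⟩ := ha 1 zero_le_one i
  obtain ⟨h3, h4⟩ := ha y hy i
  have h5 := coordSum_wordMat_mulVec_le u hy
  rw [wordMat_three_three_mulVec, coordSum_add, coordSum_smul]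
  rw [← hq] at h1 h2 h5 ⊢
  simp only [Pi.add_apply, Pi.smul_apply, smul_eq_mul]
  set s := coordSum y
  set z := wordMat u *ᵥ y
  set Q := coordSum q
  obtain ⟨p, hp⟩ : ∃ p, q i = p * Q := ⟨q i / Q, by field_simp⟩
  rw [hp] at h1 h2 ⊢
  rw [mul_div_assoc, div_self hQ.ne', mul_one]
  have h1' : a i ≤ p := le_of_mul_le_mul_right h1 hQ
  have h2' : p ≤ a i + δ := le_of_mul_le_mul_right h2 hQ
  constructor
  · nlinarith [mul_nonneg (sub_nonneg.2 h1') (sub_nonneg.2 h5)]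
  · nlinarith [mul_nonneg (sub_nonneg.2 h2') (sub_nonneg.2 h5)]

lemma exists_wordMat_mulVec_iterate {x : Fin 3 → ℝ} (hx : x ∈ simplexBar) (n : ℕ) :
    ∃ c : ℝ, 0 < c ∧ wordMat (word n x) *ᵥ fR^[n] x = c • x := by
  induction n with
  | zero => exact ⟨1, one_pos, by simp [word, wordMat]⟩
  | succ n ih =>
    obtain ⟨c, hc, h⟩ := ih
    obtain ⟨d, hd, h'⟩ := Mat_digit_mulVec_fR (iterate_fR_mem_simplexBar hx n)
    refine ⟨d * c, mul_pos hd hc, ?_⟩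
    rw [word, wordMat_cons_mulVec, Function.iterate_succ_apply', h', Matrix.mulVec_smul, h,
      smul_smul]

lemma OscLE.dist_le {w : List (Fin 4)} {δ : ℝ} (h : OscLE w δ) (hδ : 0 ≤ δ) {x y : Fin 3 → ℝ}
    (hx : x ∈ wordCylinder w ∩ simplexBar) (hy : y ∈ wordCylinder w ∩ simplexBar) :
    dist x y ≤ δ := by
  obtain ⟨a, ha⟩ := h
  have key : ∀ z ∈ wordCylinder w ∩ simplexBar, ∀ i, a i ≤ z i ∧ z i ≤ a i + δ := fun z hz i => by
    obtain ⟨c, hc, h⟩ := exists_wordMat_mulVec_iterate hz.2 w.length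
    rw [show word w.length z = w from hz.1] at h
    have h' := ha _ (iterate_fR_mem_simplexBar hz.2 w.length).1 i
    rw [h, coordSum_smul, coordSum_eq_one hz.2, mul_one, Pi.smul_apply, smul_eq_mul] at h'
    exact ⟨by nlinarith, by nlinarith⟩
  refine (dist_pi_le_iff hδ).2 fun i => ?_
  rw [Real.dist_eq, abs_le]
  have h1 := key x hx i
  have h2 := key y hy i
  constructor <;> linarith

lemma word_add_two {x : Fin 3 → ℝ} {n : ℕ} (h : fR^[n] x ∈ wordCylinder [3, 3]) :
    word (n + 2) x = 3 :: 3 :: word n x := by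
  have h' : digit (fR (fR^[n] x)) = 3 ∧ digit (fR^[n] x) = 3 := by
    simpa [wordCylinder, word] using h
  rw [word, word, Function.iterate_succ_apply', h'.1, h'.2]

lemma OscLE.word_of_le {x : Fin 3 → ℝ} {δ : ℝ} {n m : ℕ} (h : OscLE (word n x) δ) (hnm : n ≤ m) :
    OscLE (word m x) δ := by
  induction m, hnm using Nat.le_induction with
  | base => exact h
  | succ m _ ih => exact ih.cons _

lemma exists_oscLE {x : Fin 3 → ℝ} (hx : ∀ m, ∃ n, m ≤ n ∧ fR^[n] x ∈ wordCylinder [3, 3])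
    (k : ℕ) : ∃ n, OscLE (word n x) ((1 / 2) ^ k) := by
  induction k with
  | zero => exact ⟨0, by simpa [word] using oscLE_nil⟩
  | succ k ih =>
    obtain ⟨n, hn⟩ := ih
    obtain ⟨m, hm, hV⟩ := hx n
    refine ⟨m + 2, ?_⟩
    rw [word_add_two hV, pow_succ, mul_one_div]
    exact (hn.word_of_le hm).three_three

/-- A point that reads `3, 3` infinitely often lies, inside any open set containing it, in a cylinder
ending with `3, 3`. -/
lemma exists_wordCylinder_subset {x : Fin 3 → ℝ}
    (hx : ∀ m, ∃ n, m ≤ n ∧ fR^[n] x ∈ wordCylinder [3, 3]) (hxS : x ∈ simplexBar)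
    {U : Set (Fin 3 → ℝ)} (hU : IsOpen U) (hxU : x ∈ U) :
    ∃ n, (∃ u, word n x = 3 :: 3 :: u) ∧ wordCylinder (word n x) ∩ simplexBar ⊆ U := by
  obtain ⟨ε, hε, hball⟩ := Metric.isOpen_iff.1 hU x hxU
  obtain ⟨k, hk⟩ := exists_pow_lt_of_lt_one hε (by norm_num : (1 / 2 : ℝ) < 1)
  obtain ⟨n, hn⟩ := exists_oscLE hx k
  obtain ⟨m, hm, hV⟩ := hx n
  refine ⟨m + 2, ⟨_, word_add_two hV⟩, fun y hy => hball ?_⟩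
  exact ((hn.word_of_le (hm.trans (Nat.le_add_right m 2))).dist_le (by positivity) hy
    ⟨mem_wordCylinder_word _ x, hxS⟩).trans_lt hk

/-- The words satisfying `P` for which no earlier word of a point of their cylinder does. -/
def firstWords (P : List (Fin 4) → Prop) : Set (List (Fin 4)) :=
  {w | P w ∧ ∀ x ∈ wordCylinder w, ∀ n < w.length, ¬ P (word n x)}

lemma pairwise_disjoint_firstWords (P : List (Fin 4) → Prop) :
    (firstWords P).PairwiseDisjoint wordCylinder := by
  intro v hv w hw hne
  refine Set.disjoint_left.2 fun x hxv hxw => hne ?_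
  have hv' : word v.length x = v := hxv
  have hw' : word w.length x = w := hxw
  rcases lt_trichotomy v.length w.length with h | h | h
  · exact absurd (hv'.symm ▸ hv.1) (hw.2 x hxw _ h)
  · rw [← hv', h, hw']
  · exact absurd (hw'.symm ▸ hw.1) (hv.2 x hxv _ h)

lemma word_eq_of_word_eq {x y : Fin 3 → ℝ} {m n : ℕ} (hmn : m ≤ n) (h : word n x = word n y) :
    word m x = word m y := by
  induction n, hmn using Nat.le_induction with
  | base => exact h
  | succ n _ ih =>
    simp only [word, List.cons.injEq] at h
    exact ih h.2

lemma exists_mem_firstWords {P : List (Fin 4) → Prop} {x : Fin 3 → ℝ} (h : ∃ n, P (word n x)) :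
    ∃ w ∈ firstWords P, x ∈ wordCylinder w := by
  classical
  refine ⟨word (Nat.find h) x, ⟨Nat.find_spec h, fun y hy n hn => ?_⟩, mem_wordCylinder_word _ x⟩
  rw [length_word] at hn
  have hy' : word (Nat.find h) y = word (Nat.find h) x := by
    simpa [wordCylinder, length_word] using hy
  rw [word_eq_of_word_eq hn.le hy']
  exact Nat.find_min h hn

lemma lam_mul_lam_sdiff_eq_zero {E : Set (Fin 3 → ℝ)} (hE : MeasurableSet E) (hES : E ⊆ simplexBar)
    (hinv : ∀ x ∈ simplexBar, x ∈ E ↔ fR x ∈ E) : lam E * lam (simplexBar \ E) = 0 := by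
  set B := simplexBar \ E with hB
  have hBm : MeasurableSet B := measurableSet_simplexBar.diff hE
  have hiter : ∀ x ∈ simplexBar, ∀ n, fR^[n] x ∈ B → x ∈ B := fun x hx n => by
    induction n with
    | zero => exact id
    | succ n ih =>
      rw [Function.iterate_succ_apply']
      exact fun h => ih ⟨iterate_fR_mem_simplexBar hx n,
        fun h' => h.2 ((hinv _ (iterate_fR_mem_simplexBar hx n)).1 h')⟩
  have hbound : ∀ ε : ENNReal, ε ≠ 0 → lam E * lam B ≤ 8 * ε := fun ε hε => by
    obtain ⟨U, hEU, hUo, hUlt⟩ := E.exists_isOpen_lt_add (μ := lam) (measure_ne_top _ _) hε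
    set P : List (Fin 4) → Prop := fun w =>
      (∃ u, w = 3 :: 3 :: u) ∧ wordCylinder w ∩ simplexBar ⊆ U
    have hcov : lam E ≤ ∑' w : firstWords P, lam (wordCylinder w) := by
      refine le_trans (measure_mono_ae ?_) (measure_iUnion_le _)
      filter_upwards [ae_frequently_mem_wordCylinder] with x hx hxE
      obtain ⟨w, hw, hxw⟩ := exists_mem_firstWords (P := P)
        (exists_wordCylinder_subset hx (hES hxE) hUo (hEU hxE))
      exact Set.mem_iUnion.2 ⟨⟨w, hw⟩, hxw⟩
    have hterm : ∀ w : firstWords P,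
        lam (wordCylinder w) * lam B ≤ 8 * lam (wordCylinder w ∩ (B ∩ U)) := by
      rintro ⟨w, ⟨⟨u, rfl⟩, hwU⟩, -⟩
      obtain ⟨c, -, hc, hle⟩ := exists_distortion_bound u
      calc _ ≤ 8 * c * lam B := by gcongr
        _ = 8 * (c * lam B) := mul_assoc _ _ _
        _ ≤ 8 * lam (wordCylinder (3 :: 3 :: u) ∩ fR^[(3 :: 3 :: u).length] ⁻¹' B) := by
          gcongr
          exact hle B hBm
        _ ≤ _ := by
          refine mul_le_mul_right (measure_mono_ae ?_) _
          filter_upwards [ae_lam_mem_simplexBar] with x hx hxw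
          exact ⟨hxw.1, hiter x hx _ hxw.2, hwU ⟨hxw.1, hx⟩⟩
    calc lam E * lam B ≤ (∑' w : firstWords P, lam (wordCylinder w)) * lam B := by gcongr
      _ = ∑' w : firstWords P, lam (wordCylinder w) * lam B := ENNReal.tsum_mul_right.symm
      _ ≤ ∑' w : firstWords P, 8 * lam (wordCylinder w ∩ (B ∩ U)) := ENNReal.tsum_le_tsum hterm
      _ = 8 * ∑' w : firstWords P, lam (wordCylinder w ∩ (B ∩ U)) := ENNReal.tsum_mul_left
      _ = 8 * lam (⋃ w : firstWords P, wordCylinder w ∩ (B ∩ U)) := by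
        rw [measure_iUnion]
        · exact fun v w hvw => ((pairwise_disjoint_firstWords P) v.2 w.2
            (Subtype.coe_injective.ne hvw)).mono Set.inter_subset_left Set.inter_subset_left
        · exact fun w => (measurableSet_wordCylinder _).inter (hBm.inter hUo.measurableSet)
      _ ≤ 8 * lam (U \ E) := by
        gcongr
        exact Set.iUnion_subset fun w x hx => ⟨hx.2.2, hx.2.1.2⟩
      _ ≤ 8 * ε := by
        gcongr
        rw [measure_sdiff hEU hE.nullMeasurableSet (measure_ne_top _ _)]
        exact tsub_le_iff_left.2 hUlt.le
  by_contra hne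
  have hfin : lam E * lam B ≠ ⊤ := ENNReal.mul_ne_top (measure_ne_top _ _) (measure_ne_top _ _)
  have h := hbound (lam E * lam B / 16) (by simp [hne])
  have h16 : 8 * (lam E * lam B / 16) = lam E * lam B / 2 := by
    rw [← mul_div_assoc, mul_comm, show (16 : ENNReal) = 2 * 8 by norm_num]
    exact ENNReal.mul_div_mul_right _ _ (by norm_num) (by norm_num)
  rw [h16] at h
  exact absurd (ENNReal.half_lt_self hne hfin) (not_lt.2 h)

/-- The Reverse algorithm is ergodic with respect to the invariant measure μ:
`f_R` preserves μ, and every Borel set `E ⊆ Δ̄` that is invariant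
(`f_R⁻¹(E) = E` within `Δ̄`) has measure 0 or full measure. -/
theorem reverse_ergodic :
    MeasurePreserving fR muR muR ∧
    ∀ E : Set (Fin 3 → ℝ), MeasurableSet E → E ⊆ simplexBar →
      (∀ x ∈ simplexBar, x ∈ E ↔ fR x ∈ E) →
      muR E = 0 ∨ muR (simplexBar \ E) = 0 := by
  refine ⟨measurePreserving_fR, fun E hE hES hinv => ?_⟩
  rcases mul_eq_zero.1 (lam_mul_lam_sdiff_eq_zero hE hES hinv) with h | h
  · exact Or.inl (muR_absolutelyContinuous_lam h)
  · exact Or.inr (muR_absolutelyContinuous_lam h)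

end
end

section
/- If τ = (τₙ) ∈ {σ₁,σ₂,σ₃,σ₄}^ℕ is a directive sequence in which the block consisting of (σ₁,σ₂,σ₃) repeated 9 times (a block of length 27) has positive density, then the S-adic language L_τ is letter balanced: there exists C > 0 such that every pair (v₁,v₂) ∈ L_τ × L_τ with |v₁| = |v₂| satisfies | |v₁|ᵢ − |v₂|ᵢ | ≤ C for every letter i ∈ {1,2,3}. -/
/-- Finite words over the alphabet {1,2,3}, encoded as lists over `Fin 3`
(letter k+1 is encoded by `k : Fin 3`). -/
abbrev Word := List (Fin 3)

/-- The substitution σ₁ : 1↦1, 2↦21, 3↦31. -/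
def s1 : Fin 3 → Word := ![[0], [1,0], [2,0]]
/-- The substitution σ₂ : 1↦12, 2↦2, 3↦32. -/
def s2 : Fin 3 → Word := ![[0,1], [1], [2,1]]
/-- The substitution σ₃ : 1↦13, 2↦23, 3↦3. -/
def s3 : Fin 3 → Word := ![[0,2], [1,2], [2]]
/-- The substitution σ₄ : 1↦23, 2↦31, 3↦12. -/
def s4 : Fin 3 → Word := ![[1,2], [2,0], [0,1]]

/-- Apply a substitution to a word (the monoid-endomorphism extension). -/
def subApply (σ : Fin 3 → Word) (w : Word) : Word := w.flatMap σ

/-- `applySeq τ n w = (τ₀ ∘ τ₁ ∘ ⋯ ∘ τ_{n-1})(w)`. -/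
def applySeq (τ : ℕ → Fin 3 → Word) : ℕ → Word → Word
  | 0, w => w
  | n+1, w => applySeq τ n (subApply (τ n) w)

/-- The S-adic language of a directive sequence τ: all factors of the words
`(τ₀ ∘ ⋯ ∘ τ_{n-1})(i)` for n ∈ ℕ and letters i. -/
def Lang (τ : ℕ → Fin 3 → Word) : Set Word :=
  {v | ∃ n : ℕ, ∃ i : Fin 3, v <:+: applySeq τ n [i]}

/-- Number of (possibly overlapping) occurrences of `v` as a factor of `w`. -/
def occ (v w : Word) : ℕ :=
  ((List.range (w.length + 1 - v.length)).filter
    (fun k => (w.drop k).take v.length = v)).length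

/-- The periodic sequence of substitutions σ₁σ₂σ₃σ₁σ₂σ₃⋯ . -/
def blockFn : ℕ → (Fin 3 → Word) :=
  fun j => if j % 3 = 0 then s1 else if j % 3 = 1 then s2 else s3

/-- The block (σ₁,σ₂,σ₃) repeated 9 times (length 27) has positive density in τ. -/
def hasPosDensity (τ : ℕ → Fin 3 → Word) : Prop :=
  ∃ d : ℝ, 0 < d ∧ Filter.Tendsto
    (fun n : ℕ =>
      (({k : ℕ | k + 27 ≤ n ∧ ∀ j < 27, τ (k + j) = blockFn j}).ncard : ℝ) / n)
    Filter.atTop (nhds d)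

/-- The total weight of a word when letter `j` has weight `φ j`. -/
def wt (φ : Fin 3 → ℝ) (w : Word) : ℝ := (w.map φ).sum

/-- The weight function `φ ∘ σ`, i.e. the transposed action of a substitution on weights. -/
def pull (σ : Fin 3 → Word) (φ : Fin 3 → ℝ) : Fin 3 → ℝ := fun j => wt φ (σ j)

/-- The weight function pulled back through `τ₀ ∘ ⋯ ∘ τ_{n-1}`. -/
def pullSeq (τ : ℕ → Fin 3 → Word) (φ : Fin 3 → ℝ) : ℕ → Fin 3 → ℝ
  | 0 => φ
  | n + 1 => pull (τ n) (pullSeq τ φ n)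

/-- The oscillation of the weights is at most `d`. -/
def Osc (φ : Fin 3 → ℝ) (d : ℝ) : Prop := ∀ i j, φ i - φ j ≤ d

/-- The weights are neither all positive nor all negative. -/
def Mixed (φ : Fin 3 → ℝ) : Prop := (∃ i, φ i ≤ 0) ∧ ∃ j, 0 ≤ φ j

/-- Membership in the set of the four substitutions. -/
def IsSigma (σ : Fin 3 → Word) : Prop := σ = s1 ∨ σ = s2 ∨ σ = s3 ∨ σ = s4

/-- Starting positions of the occurrences of the length-27 block ending before `n`. -/
def blockStarts (τ : ℕ → Fin 3 → Word) (n : ℕ) : Set ℕ :=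
  {k : ℕ | k + 27 ≤ n ∧ ∀ j < 27, τ (k + j) = blockFn j}

@[simp] lemma wt_nil (φ : Fin 3 → ℝ) : wt φ [] = 0 := by simp [wt]

@[simp] lemma wt_cons (φ : Fin 3 → ℝ) (a : Fin 3) (w : Word) :
    wt φ (a :: w) = φ a + wt φ w := by simp [wt]

@[simp] lemma wt_append (φ : Fin 3 → ℝ) (u w : Word) : wt φ (u ++ w) = wt φ u + wt φ w := by
  simp [wt]

lemma wt_subApply (σ : Fin 3 → Word) (φ : Fin 3 → ℝ) (w : Word) :
    wt φ (subApply σ w) = wt (pull σ φ) w := by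
  induction w with
  | nil => simp [subApply]
  | cons a w ih =>
    have : subApply σ (a :: w) = σ a ++ subApply σ w := by simp [subApply]
    rw [this, wt_append, ih, wt_cons, pull]

lemma wt_applySeq (τ : ℕ → Fin 3 → Word) (φ : Fin 3 → ℝ) (n : ℕ) (w : Word) :
    wt φ (applySeq τ n w) = wt (pullSeq τ φ n) w := by
  induction n generalizing w with
  | zero => rfl
  | succ n ih => rw [applySeq, ih, wt_subApply, pullSeq]

lemma mixed_of_wt_eq_zero {φ : Fin 3 → ℝ} {w : Word} (hw : w ≠ []) (h : wt φ w = 0) :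
    Mixed φ := by
  have pos : ∀ (ψ : Fin 3 → ℝ) (u : Word), u ≠ [] → (∀ i, 0 < ψ i) → 0 < wt ψ u := by
    intro ψ u hu hψ
    refine List.sum_pos _ ?_ (by simpa using hu)
    simp only [List.mem_map]
    rintro _ ⟨a, -, rfl⟩
    exact hψ a
  have neg : wt (fun i => -φ i) w = -wt φ w := by
    clear h hw
    induction w with
    | nil => simp
    | cons a w ih => rw [wt_cons, wt_cons, ih]; ring
  constructor
  · by_contra! hc
    exact (pos φ w hw hc).ne' h
  · by_contra! hc
    have := pos (fun i => -φ i) w hw (fun i => by linarith [hc i])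
    linarith

lemma abs_le_of_mixed {φ : Fin 3 → ℝ} {d : ℝ} (hm : Mixed φ) (ho : Osc φ d) (i : Fin 3) :
    |φ i| ≤ d := by
  obtain ⟨⟨a, ha⟩, b, hb⟩ := hm
  have h1 := ho i a
  have h2 := ho b i
  rw [abs_le]
  constructor <;> linarith

lemma abs_wt_le {φ : Fin 3 → ℝ} {d : ℝ} (h : ∀ i, |φ i| ≤ d) (w : Word) :
    |wt φ w| ≤ w.length * d := by
  induction w with
  | nil => simp
  | cons a w ih =>
    rw [wt_cons, List.length_cons]
    push_cast
    have := abs_add_le (φ a) (wt φ w)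
    linarith [h a]

lemma Osc.pull {φ : Fin 3 → ℝ} {d : ℝ} {σ : Fin 3 → Word} (hσ : IsSigma σ) (hm : Mixed φ)
    (ho : Osc φ d) : Osc (pull σ φ) d := by
  have hle := fun i => abs_le.mp (abs_le_of_mixed hm ho i)
  have := hle 0
  have := hle 1
  have := hle 2
  have := ho 0 1
  have := ho 0 2
  have := ho 1 0
  have := ho 1 2
  have := ho 2 0
  have := ho 2 1
  intro i j
  rcases hσ with rfl | rfl | rfl | rfl <;> fin_cases i <;> fin_cases j <;>
    simp [_root_.pull, s1, s2, s3, s4] <;> linarith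

lemma Osc.pull_block {φ : Fin 3 → ℝ} {d : ℝ} (ho : Osc φ d)
    (hm : Mixed (_root_.pull s3 (_root_.pull s2 (_root_.pull s1 φ)))) :
    Osc (_root_.pull s3 (_root_.pull s2 (_root_.pull s1 φ))) (3 / 4 * d) := by
  have e0 : _root_.pull s3 (_root_.pull s2 (_root_.pull s1 φ)) 0 = 4 * φ 0 + 2 * φ 1 + φ 2 := by
    simp [_root_.pull, s1, s2, s3]; ring
  have e1 : _root_.pull s3 (_root_.pull s2 (_root_.pull s1 φ)) 1 = 3 * φ 0 + 2 * φ 1 + φ 2 := by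
    simp [_root_.pull, s1, s2, s3]; ring
  have e2 : _root_.pull s3 (_root_.pull s2 (_root_.pull s1 φ)) 2 = 2 * φ 0 + φ 1 + φ 2 := by
    simp [_root_.pull, s1, s2, s3]; ring
  have := ho 0 1
  have := ho 0 2
  have := ho 1 0
  have := ho 1 2
  have := ho 2 0
  have := ho 2 1
  obtain ⟨⟨a, ha⟩, b, hb⟩ := hm
  intro i j
  fin_cases a <;> fin_cases b <;> fin_cases i <;> fin_cases j <;>
    simp only [Fin.zero_eta, Fin.mk_one, Fin.reduceFinMk, e0, e1, e2] at ha hb ⊢ <;> linarith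

lemma IsSigma.length_le {σ : Fin 3 → Word} (h : IsSigma σ) (i : Fin 3) : (σ i).length ≤ 2 := by
  rcases h with rfl | rfl | rfl | rfl <;> fin_cases i <;> simp [s1, s2, s3, s4]

lemma IsSigma.subApply_ne_nil {σ : Fin 3 → Word} (h : IsSigma σ) {w : Word} (hw : w ≠ []) :
    subApply σ w ≠ [] := by
  obtain ⟨a, w, rfl⟩ := List.exists_cons_of_ne_nil hw
  have : σ a ≠ [] := by
    rcases h with rfl | rfl | rfl | rfl <;> fin_cases a <;> simp [s1, s2, s3, s4]
  simp [subApply, this]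

lemma prefix_or_exists_of_prefix_append {v x y : Word} (h : v <+: x ++ y) :
    v <+: x ∨ ∃ t, v = x ++ t ∧ t <+: y := by
  rcases List.prefix_or_prefix_of_prefix h (List.prefix_append x y) with h' | ⟨t, rfl⟩
  · exact Or.inl h'
  · exact Or.inr ⟨t, rfl, (List.prefix_append_right_inj x).mp h⟩

lemma prefix_subApply {σ : Fin 3 → Word} (h : IsSigma σ) {v w : Word}
    (hv : v <+: subApply σ w) :
    ∃ u p : Word, u <+: w ∧ p.length ≤ 2 ∧ v = subApply σ u ++ p := by
  induction w generalizing v with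
  | nil => exact ⟨[], [], by simp, by simp, by simpa [subApply] using hv⟩
  | cons a w ih =>
    have e : ∀ u, subApply σ (a :: u) = σ a ++ subApply σ u := by simp [subApply]
    rw [e] at hv
    rcases prefix_or_exists_of_prefix_append hv with hv | ⟨t, rfl, ht⟩
    · exact ⟨[], v, by simp, hv.length_le.trans (h.length_le a), by simp [subApply]⟩
    · obtain ⟨u, p, hu, hp, rfl⟩ := ih ht
      exact ⟨a :: u, p, by simpa using hu, hp, by simp [e]⟩

lemma suffix_subApply {σ : Fin 3 → Word} (h : IsSigma σ) {v w : Word}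
    (hv : v <:+ subApply σ w) :
    ∃ s u : Word, u <:+ w ∧ s.length ≤ 2 ∧ v = s ++ subApply σ u := by
  induction w with
  | nil => exact ⟨[], [], by simp, by simp, by simpa [subApply] using hv⟩
  | cons a w ih =>
    have e : subApply σ (a :: w) = σ a ++ subApply σ w := by simp [subApply]
    rcases List.suffix_or_suffix_of_suffix hv (e ▸ List.suffix_append (σ a) (subApply σ w))
      with hv' | hv'
    · obtain ⟨s, u, hu, hs, rfl⟩ := ih hv'
      exact ⟨s, u, hu.trans (List.suffix_cons a w), hs, rfl⟩
    · obtain ⟨s, rfl⟩ := hv'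
      refine ⟨s, w, List.suffix_cons a w, ?_, rfl⟩
      have h1 := hv.length_le
      have h2 := h.length_le a
      rw [e] at h1
      simp only [List.length_append] at h1
      omega

lemma infix_subApply {σ : Fin 3 → Word} (h : IsSigma σ) {v w : Word}
    (hv : v <:+: subApply σ w) :
    ∃ s u p : Word, u <:+: w ∧ s.length ≤ 2 ∧ p.length ≤ 2 ∧ v = s ++ subApply σ u ++ p := by
  obtain ⟨t, hvt, ht⟩ := List.infix_iff_prefix_suffix.mp hv
  obtain ⟨s, u, hu, hs, rfl⟩ := suffix_subApply h ht
  rcases prefix_or_exists_of_prefix_append hvt with hvt | ⟨v', rfl, hv'⟩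
  · exact ⟨v, [], [], by simp, hvt.length_le.trans hs, by simp, by simp [subApply]⟩
  · obtain ⟨u', p, hu', hp, rfl⟩ := prefix_subApply h hv'
    exact ⟨s, u', p, hu'.isInfix.trans hu.isInfix, hs, hp, by simp⟩

lemma exists_applySeq_eq {τ : ℕ → Fin 3 → Word} (hτ : ∀ n, IsSigma (τ n)) {n N : ℕ} (h : n ≤ N)
    {w : Word} (hw : w ≠ []) : ∃ u : Word, u ≠ [] ∧ applySeq τ N w = applySeq τ n u := by
  induction N, h using Nat.le_induction generalizing w with
  | base => exact ⟨w, hw, rfl⟩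
  | succ N _ ih => exact ih ((hτ N).subApply_ne_nil hw)

lemma mixed_pullSeq {τ : ℕ → Fin 3 → Word} (hτ : ∀ n, IsSigma (τ n)) {φ : Fin 3 → ℝ}
    {n N : ℕ} (h : n ≤ N) {w : Word} (hw : w ≠ []) (h0 : wt φ (applySeq τ N w) = 0) :
    Mixed (pullSeq τ φ n) := by
  obtain ⟨u, hu, e⟩ := exists_applySeq_eq hτ h hw
  rw [e, wt_applySeq] at h0
  exact mixed_of_wt_eq_zero hu h0

lemma osc_pullSeq_mono {τ : ℕ → Fin 3 → Word} (hτ : ∀ n, IsSigma (τ n)) {φ : Fin 3 → ℝ}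
    {N : ℕ} (hm : ∀ n ≤ N, Mixed (pullSeq τ φ n)) {d : ℝ} {m n : ℕ} (hmn : m ≤ n) (hn : n ≤ N)
    (ho : Osc (pullSeq τ φ m) d) : Osc (pullSeq τ φ n) d := by
  induction n, hmn using Nat.le_induction with
  | base => exact ho
  | succ n _ ih => exact (ih (by omega)).pull (hτ n) (hm n (by omega))

lemma blockStarts_finite (τ : ℕ → Fin 3 → Word) (n : ℕ) : (blockStarts τ n).Finite :=
  (Set.finite_Iic n).subset fun k hk => by
    have := hk.1
    simp only [Set.mem_Iic]
    omega

lemma ncard_blockStarts_add_le (τ : ℕ → Fin 3 → Word) (m : ℕ) :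
    (blockStarts τ (m + 27)).ncard ≤ (blockStarts τ m).ncard + 27 := by
  have hsub : blockStarts τ (m + 27) ⊆ blockStarts τ m ∪ (Finset.Icc (m - 26) m : Finset ℕ) := by
    rintro k ⟨hk, hb⟩
    by_cases h : k + 27 ≤ m
    · exact Or.inl ⟨h, hb⟩
    · refine Or.inr ?_
      simp only [Finset.coe_Icc, Set.mem_Icc]
      omega
  have h1 := Set.ncard_le_ncard hsub ((blockStarts_finite τ m).union (Finset.finite_toSet _))
  have h2 := Set.ncard_union_le (blockStarts τ m) (Finset.Icc (m - 26) m : Finset ℕ)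
  rw [Set.ncard_coe_finset, Nat.card_Icc] at h2
  omega

lemma osc_pullSeq_le {τ : ℕ → Fin 3 → Word} (hτ : ∀ n, IsSigma (τ n)) {φ : Fin 3 → ℝ}
    {N : ℕ} (hm : ∀ n ≤ N, Mixed (pullSeq τ φ n)) (h1 : Osc φ 1) {n : ℕ} (hn : n ≤ N) :
    Osc (pullSeq τ φ n) ((99 / 100 : ℝ) ^ (blockStarts τ n).ncard) := by
  have weaken : ∀ {ψ : Fin 3 → ℝ} {c d : ℝ}, Osc ψ c → c ≤ d → Osc ψ d :=
    fun h hcd i j => (h i j).trans hcd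
  induction n using Nat.strong_induction_on with
  | _ n ih =>
  by_cases hb : ∃ m, n = m + 27 ∧ ∀ j < 27, τ (m + j) = blockFn j
  · obtain ⟨m, rfl, hb⟩ := hb
    have e : pullSeq τ φ (m + 3) = pull s3 (pull s2 (pull s1 (pullSeq τ φ m))) := by
      have h0 : τ m = s1 := by simpa [blockFn] using hb 0 (by norm_num)
      have h1 : τ (m + 1) = s2 := by simpa [blockFn] using hb 1 (by norm_num)
      have h2 : τ (m + 2) = s3 := by simpa [blockFn] using hb 2 (by norm_num)
      simp [pullSeq, h0, h1, h2]
    have hm3 := hm (m + 3) (by omega)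
    rw [e] at hm3
    have h3 := (ih m (by omega) (by omega)).pull_block hm3
    rw [← e] at h3
    refine weaken (osc_pullSeq_mono hτ hm (by omega) hn h3) ?_
    calc (3 / 4 : ℝ) * (99 / 100) ^ (blockStarts τ m).ncard
        ≤ (99 / 100) ^ 27 * (99 / 100) ^ (blockStarts τ m).ncard := by
          gcongr
          norm_num
      _ = (99 / 100) ^ ((blockStarts τ m).ncard + 27) := by ring
      _ ≤ _ := pow_le_pow_of_le_one (by norm_num) (by norm_num) (ncard_blockStarts_add_le τ m)
  · rcases n with _ | n
    · have : blockStarts τ 0 = ∅ := by ext k; simp [blockStarts]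
      rw [this]
      simpa [pullSeq] using h1
    · refine weaken (osc_pullSeq_mono hτ hm n.le_succ hn (ih n (by omega) (by omega))) ?_
      refine pow_le_pow_of_le_one (by norm_num) (by norm_num) ?_
      refine Set.ncard_le_ncard ?_ (blockStarts_finite τ n)
      rintro k ⟨hk, hkb⟩
      refine ⟨?_, hkb⟩
      by_contra hlt
      exact hb ⟨k, by omega, hkb⟩

lemma summable_pow_blockStarts {τ : ℕ → Fin 3 → Word} (hd : hasPosDensity τ) :
    Summable fun n => (99 / 100 : ℝ) ^ (blockStarts τ n).ncard := by
  obtain ⟨d, hd, hlim⟩ := hd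
  have hr : (99 / 100 : ℝ) ^ (d / 2) < 1 :=
    Real.rpow_lt_one (by norm_num) (by norm_num) (by linarith)
  have hr0 : (0 : ℝ) ≤ (99 / 100 : ℝ) ^ (d / 2) := by positivity
  refine (summable_geometric_of_lt_one hr0 hr).of_norm_bounded_eventually_nat ?_
  filter_upwards [hlim.eventually (lt_mem_nhds (half_lt_self hd)), Filter.eventually_gt_atTop 0]
    with n hn hpos
  have hpos' : (0 : ℝ) < n := by exact_mod_cast hpos
  have hn' : d / 2 * n ≤ ((blockStarts τ n).ncard : ℝ) := ((lt_div_iff₀ hpos').mp hn).le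
  rw [Real.norm_of_nonneg (by positivity), ← Real.rpow_natCast, ← Real.rpow_natCast,
    ← Real.rpow_mul (by norm_num)]
  exact Real.rpow_le_rpow_of_exponent_ge (by norm_num) (by norm_num) hn'

lemma exists_infix_wt_sub_le {τ : ℕ → Fin 3 → Word} (hτ : ∀ n, IsSigma (τ n)) {φ : Fin 3 → ℝ}
    {b : ℕ → ℝ} {n : ℕ} (hb : ∀ k < n, ∀ i, |pullSeq τ φ k i| ≤ b k) {v w : Word}
    (hv : v <:+: applySeq τ n w) :
    ∃ u : Word, u <:+: w ∧ |wt φ v - wt (pullSeq τ φ n) u| ≤ ∑ k ∈ Finset.range n, 4 * b k := by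
  induction n generalizing w with
  | zero => exact ⟨v, hv, by simp [pullSeq]⟩
  | succ n ih =>
    obtain ⟨u', hu', hle⟩ := ih (fun k hk => hb k (by omega)) hv
    obtain ⟨s, u, p, hu, hs, hp, rfl⟩ := infix_subApply (hτ n) hu'
    refine ⟨u, hu, ?_⟩
    have hbn := hb n (by omega)
    have hb0 : 0 ≤ b n := (abs_nonneg _).trans (hbn 0)
    have short : ∀ x : Word, x.length ≤ 2 → |wt (pullSeq τ φ n) x| ≤ 2 * b n := fun x hx =>
      (abs_wt_le hbn x).trans (mul_le_mul_of_nonneg_right (by exact_mod_cast hx) hb0)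
    have hs' := abs_le.mp (short s hs)
    have hp' := abs_le.mp (short p hp)
    rw [wt_append, wt_append, wt_subApply] at hle
    have hle' := abs_le.mp hle
    rw [Finset.sum_range_succ, pullSeq, abs_le]
    constructor <;> linarith [hle'.1, hle'.2]

lemma wt_indicator_sub (i : Fin 3) (c : ℝ) (w : Word) :
    wt (fun j => (if j = i then 1 else 0) - c) w = w.count i - c * w.length := by
  induction w with
  | nil => simp
  | cons a w ih =>
    rw [wt_cons, ih, List.count_cons, List.length_cons]
    by_cases h : a = i <;> simp [h] <;> ring

/-- If the block ((σ₁,σ₂,σ₃) repeated 9 times) has positive density in the directive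
sequence τ ∈ {σ₁,σ₂,σ₃,σ₄}^ℕ, then the S-adic language L_τ is letter balanced. -/
theorem Lang_letter_balanced (τ : ℕ → Fin 3 → Word)
    (hτ : ∀ n, τ n = s1 ∨ τ n = s2 ∨ τ n = s3 ∨ τ n = s4)
    (hd : hasPosDensity τ) :
    ∃ C : ℝ, 0 < C ∧ ∀ v₁ ∈ Lang τ, ∀ v₂ ∈ Lang τ, v₁.length = v₂.length →
      ∀ i : Fin 3, |(v₁.count i : ℝ) - (v₂.count i : ℝ)| ≤ C := by
  have hsum := (summable_pow_blockStarts hd).mul_left 4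
  set b : ℕ → ℝ := fun n => (99 / 100 : ℝ) ^ (blockStarts τ n).ncard
  have hb0 : ∀ n, 0 ≤ 4 * b n := fun n => by positivity
  have hT : 0 ≤ ∑' n, 4 * b n := tsum_nonneg hb0
  refine ⟨2 * ((∑' n, 4 * b n) + 1), by linarith, ?_⟩
  rintro v₁ ⟨n₁, i₁, h₁⟩ v₂ ⟨n₂, i₂, h₂⟩ hlen i
  set N := max n₁ n₂
  set W := applySeq τ N [0]
  have hWne : W ≠ [] := by
    have : ∀ n (w : Word), w ≠ [] → applySeq τ n w ≠ [] := by
      intro n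
      induction n with
      | zero => exact fun w hw => hw
      | succ n ih => exact fun w hw => ih _ (IsSigma.subApply_ne_nil (hτ n) hw)
    exact this N [0] (by simp)
  have hWlen : (W.length : ℝ) ≠ 0 := by simpa using hWne
  set c : ℝ := W.count i / W.length with hc
  set φ : Fin 3 → ℝ := fun j => (if j = i then 1 else 0) - c with hφ
  have hφW : wt φ W = 0 := by
    rw [hφ, wt_indicator_sub, hc]
    field_simp
    ring
  have hm : ∀ n ≤ N, Mixed (pullSeq τ φ n) := fun n hn =>
    mixed_pullSeq hτ hn (w := [0]) (by simp) hφW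
  have hosc : Osc φ 1 := by
    intro j k
    simp only [hφ]
    split_ifs <;> linarith
  have hle : ∀ n ≤ N, ∀ j, |pullSeq τ φ n j| ≤ b n := fun n hn =>
    abs_le_of_mixed (hm n hn) (osc_pullSeq_le hτ hm hosc hn)
  have key : ∀ n ≤ N, ∀ j : Fin 3, ∀ v : Word, v <:+: applySeq τ n [j] →
      |wt φ v| ≤ (∑' n, 4 * b n) + 1 := by
    intro n hn j v hv
    obtain ⟨u, hu, hd⟩ := exists_infix_wt_sub_le hτ (fun k hk => hle k (by omega)) hv
    have hS := hsum.sum_le_tsum (Finset.range n) (fun k _ => hb0 k)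
    have hbn : b n ≤ 1 := pow_le_one₀ (by norm_num) (by norm_num)
    have hu1 : |wt (pullSeq τ φ n) u| ≤ 1 := by
      refine (abs_wt_le (fun j => (hle n hn j).trans hbn) u).trans ?_
      have := hu.length_le
      simp only [List.length_singleton] at this
      rw [mul_one]
      exact_mod_cast this
    have := abs_sub_abs_le_abs_sub (wt φ v) (wt (pullSeq τ φ n) u)
    linarith
  have k₁ := abs_le.mp (key n₁ (le_max_left _ _) i₁ v₁ h₁)
  have k₂ := abs_le.mp (key n₂ (le_max_right _ _) i₂ v₂ h₂)
  rw [hφ, wt_indicator_sub] at k₁ k₂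
  rw [hlen] at k₁
  rw [abs_le]
  constructor <;> linarith [k₁.1, k₁.2, k₂.1, k₂.2]
end

section
/- For every n ∈ ℕ and all a₀,…,a_{n−1} ∈ {1,2,3,4}, let P = M_{a₀}·M_{a₁}···M_{a_{n−1}} and, for j ∈ {0,1,2}, let s_j denote the sum of the entries of the j-th column of P. Then 2·s_j < s₀ + s₁ + s₂ for every j ∈ {0,1,2}; equivalently, the sum of the two smallest column sums of P strictly exceeds the largest column sum. -/
open Matrix

noncomputable section

/-- Strict triangle inequalities for a row vector are preserved by right multiplication by each
matrix of the Reverse algorithm. -/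
theorem triangle_vecMul_Mat (c : Fin 4) (v : Fin 3 → ℝ) (hv : ∀ j, 2 * v j < ∑ j', v j') :
    ∀ j, 2 * (v ᵥ* Mat c) j < ∑ j', (v ᵥ* Mat c) j' := by
  have h0 := hv 0
  have h1 := hv 1
  have h2 := hv 2
  simp only [Fin.sum_univ_three] at h0 h1 h2
  intro j
  fin_cases c <;> fin_cases j <;>
    simp [Mat, M1, M2, M3, M4, vecMul, dotProduct, Fin.sum_univ_three] <;> linarith

theorem triangle_vecMul_prod (l : List (Fin 4)) (v : Fin 3 → ℝ)
    (hv : ∀ j, 2 * v j < ∑ j', v j') :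
    ∀ j, 2 * (v ᵥ* (l.map Mat).prod) j < ∑ j', (v ᵥ* (l.map Mat).prod) j' := by
  induction l generalizing v with
  | nil => simpa using hv
  | cons c l ih =>
    rw [List.map_cons, List.prod_cons, ← vecMul_vecMul]
    exact ih _ (triangle_vecMul_Mat c v hv)

/-- For any product `P = M_{a₀}⋯M_{a_{n-1}}` of the Reverse matrices, twice any column
sum of P is strictly smaller than the sum of all three column sums; equivalently, the
sum of the two smallest column sums strictly exceeds the largest one. -/
theorem column_sums_triangle (n : ℕ) (a : Fin n → Fin 4) :
    ∀ j : Fin 3,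
      2 * (∑ i, (List.ofFn fun k => Mat (a k)).prod i j)
        < ∑ j' : Fin 3, ∑ i, (List.ofFn fun k => Mat (a k)).prod i j' := by
  have h := triangle_vecMul_prod (List.ofFn a) 1 (fun j => by norm_num)
  rw [List.map_ofFn, Function.comp_def] at h
  simpa only [vecMul, dotProduct, Pi.one_apply, one_mul] using h

end
end

section
/- For every n ∈ ℕ and all a₀,…,a_{n−1} ∈ {1,2,3,4}, let P = M_{a₀}···M_{a_{n−1}}·M₄ and, for j ∈ {0,1,2}, let s_j denote the sum of the entries of the j-th column of P. Then max_j s_j < 2·min_j s_j; consequently the Rényi ratio (max_j s_j / min_j s_j)³ associated with a cylinder whose digit word ends in the digit 4 is less than 2³ = 8. -/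
open Matrix

noncomputable section

/-- A positive triple in which every entry is smaller than twice a second one plus the third. -/
def IsBalanced (x y z : ℝ) : Prop :=
  (0 < x ∧ 0 < y ∧ 0 < z) ∧
    (x < 2 * y + z ∧ x < 2 * z + y) ∧ (y < 2 * x + z ∧ y < 2 * z + x) ∧
    (z < 2 * x + y ∧ z < 2 * y + x)

/-- The column sums of the matrix are balanced. -/
def HasBalancedColumnSums (P : Matrix (Fin 3) (Fin 3) ℝ) : Prop :=
  IsBalanced (∑ i, P i 0) (∑ i, P i 1) (∑ i, P i 2)

theorem hasBalancedColumnSums_one : HasBalancedColumnSums 1 := by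
  simp [HasBalancedColumnSums, IsBalanced, Matrix.one_apply]

theorem HasBalancedColumnSums.mul_Mat {P : Matrix (Fin 3) (Fin 3) ℝ}
    (h : HasBalancedColumnSums P) (d : Fin 4) : HasBalancedColumnSums (P * Mat d) := by
  simp only [HasBalancedColumnSums, IsBalanced, Fin.sum_univ_three] at h
  obtain ⟨⟨hx, hy, hz⟩, ⟨h1, h2⟩, ⟨h3, h4⟩, h5, h6⟩ := h
  fin_cases d <;>
    simp [HasBalancedColumnSums, IsBalanced, Mat, M1, M2, M3, M4, Matrix.mul_apply,
      Fin.sum_univ_three] <;>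
    refine ⟨⟨?_, ?_, ?_⟩, ⟨?_, ?_⟩, ⟨?_, ?_⟩, ?_, ?_⟩ <;> linarith

theorem hasBalancedColumnSums_prod (l : List (Fin 4)) :
    HasBalancedColumnSums (l.map Mat).prod := by
  induction l using List.reverseRecOn with
  | nil => exact hasBalancedColumnSums_one
  | append_singleton l d ih => simpa using ih.mul_Mat d

theorem HasBalancedColumnSums.sum_mul_M4_pos {P : Matrix (Fin 3) (Fin 3) ℝ}
    (h : HasBalancedColumnSums P) (k : Fin 3) : 0 < ∑ i, (P * M4) i k := by
  obtain ⟨⟨hx, hy, hz⟩, -⟩ := h.mul_Mat 3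
  fin_cases k
  exacts [hx, hy, hz]

theorem HasBalancedColumnSums.sum_mul_M4_lt {P : Matrix (Fin 3) (Fin 3) ℝ}
    (h : HasBalancedColumnSums P) (j k : Fin 3) :
    ∑ i, (P * M4) i j < 2 * ∑ i, (P * M4) i k := by
  simp only [HasBalancedColumnSums, IsBalanced, Fin.sum_univ_three] at h
  obtain ⟨⟨hx, hy, hz⟩, ⟨h1, h2⟩, ⟨h3, h4⟩, h5, h6⟩ := h
  fin_cases j <;> fin_cases k <;>
    simp [M4, Matrix.mul_apply, Fin.sum_univ_three] <;> linarith

/-- For any product `P = M_{a₀}⋯M_{a_{n-1}}·M₄`, the largest column sum is less than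
twice the smallest one; consequently the Rényi ratio `(max/min)³` is less than 8. -/
theorem column_sums_after_M4 (n : ℕ) (a : Fin n → Fin 4) :
    (∀ j k : Fin 3,
      (∑ i, ((List.ofFn fun l => Mat (a l)).prod * M4) i j)
        < 2 * ∑ i, ((List.ofFn fun l => Mat (a l)).prod * M4) i k) ∧
    (∀ j k : Fin 3,
      ((∑ i, ((List.ofFn fun l => Mat (a l)).prod * M4) i j)
        / ∑ i, ((List.ofFn fun l => Mat (a l)).prod * M4) i k) ^ 3 < 8) := by
  have hP : HasBalancedColumnSums (List.ofFn fun l => Mat (a l)).prod := by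
    simpa [List.map_ofFn, Function.comp_def] using hasBalancedColumnSums_prod (List.ofFn a)
  refine ⟨hP.sum_mul_M4_lt, fun j k => ?_⟩
  have hj := hP.sum_mul_M4_pos j
  have hk := hP.sum_mul_M4_pos k
  calc _ < (2 : ℝ) ^ 3 :=
        pow_lt_pow_left₀ ((div_lt_iff₀ hk).2 (hP.sum_mul_M4_lt j k))
          (div_nonneg hj.le hk.le) (by norm_num)
    _ = 8 := by norm_num

end
end

section
/- For μ-almost every x ∈ Δ̄, the associated sequence of digit matrices admits a generalized right eigenvector: there exists u ∈ ℝ³ with u ≠ 0 and nonnegative entries such that ⋂_{n≥0} M_{a(x)}·M_{a(f_R x)}···M_{a(f_R^{n−1} x)}·ℝ³_{≥0} = ℝ_{≥0}·u. In particular, the Reverse algorithm is topologically convergent almost everywhere. -/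
open MeasureTheory Matrix

noncomputable section

/-- The product `M_{a(x)} M_{a(f_R x)} ⋯ M_{a(f_R^{n-1} x)}` of digit matrices. -/
def prodDigits : ℕ → (Fin 3 → ℝ) → Matrix (Fin 3) (Fin 3) ℝ
  | 0, _ => 1
  | n+1, x => Mat (digit x) * prodDigits n (fR x)

/-! ### Comparable columns contract ratios -/

/-- All columns of `B` are entrywise comparable, up to a factor `4`. -/
def ComparableColumns (B : Matrix (Fin 3) (Fin 3) ℝ) : Prop :=
  ∀ r i j, B r i ≤ 4 * B r j

lemma ComparableColumns.mulVec_mul_sum_le {B : Matrix (Fin 3) (Fin 3) ℝ}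
    (hB : ComparableColumns B) {v x : Fin 3 → ℝ} (hv : ∀ i, 0 ≤ v i) (hx : ∀ i, 0 ≤ x i)
    (r : Fin 3) : (B *ᵥ v) r * ∑ j, x j ≤ 4 * ((∑ i, v i) * (B *ᵥ x) r) := by
  change (∑ i, B r i * v i) * ∑ j, x j ≤ 4 * ((∑ i, v i) * ∑ j, B r j * x j)
  rw [Finset.sum_mul_sum, Finset.sum_mul_sum, Finset.mul_sum]
  simp only [Finset.mul_sum]
  refine Finset.sum_le_sum fun i _ => Finset.sum_le_sum fun j _ => ?_
  have := mul_le_mul_of_nonneg_right (hB r i j) (mul_nonneg (hv i) (hx j))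
  linarith

/-- A block with comparable columns shrinks the range of the ratios `w i / x i` by `3 / 4`. -/
lemma ComparableColumns.exists_bracket {B : Matrix (Fin 3) (Fin 3) ℝ}
    (hB : ComparableColumns B) {w x : Fin 3 → ℝ} (hx : ∀ i, 0 < x i) {s t : ℝ}
    (hs : ∀ i, s * x i ≤ w i) (ht : ∀ i, w i ≤ t * x i) :
    ∃ s' t' : ℝ, t' - s' = 3 / 4 * (t - s) ∧
      (∀ i, s' * (B *ᵥ x) i ≤ (B *ᵥ w) i) ∧ ∀ i, (B *ᵥ w) i ≤ t' * (B *ᵥ x) i := by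
  have hX : 0 < ∑ i, x i := Finset.sum_pos (fun i _ => hx i) Finset.univ_nonempty
  set X := ∑ i, x i with hXdef
  set W := ∑ i, w i with hWdef
  have hlow (i : Fin 3) := hB.mulVec_mul_sum_le (v := x) (x := w - s • x) (fun i => (hx i).le)
    (fun i => by simpa using hs i) i
  have hupp (i : Fin 3) := hB.mulVec_mul_sum_le (v := x) (x := t • x - w) (fun i => (hx i).le)
    (fun i => by simpa using ht i) i
  simp only [mulVec_sub, mulVec_smul, Pi.sub_apply, Pi.smul_apply, smul_eq_mul,
    Finset.sum_sub_distrib, ← Finset.mul_sum, ← hXdef, ← hWdef] at hlow hupp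
  refine ⟨s + (W - s * X) / (4 * X), t - (t * X - W) / (4 * X), by field_simp; ring,
    fun i => ?_, fun i => ?_⟩
  · have h : (W - s * X) / (4 * X) * (B *ᵥ x) i ≤ (B *ᵥ w) i - s * (B *ᵥ x) i := by
      rw [div_mul_eq_mul_div, div_le_iff₀ (by positivity)]
      linarith [hlow i]
    linarith
  · have h : (t * X - W) / (4 * X) * (B *ᵥ x) i ≤ t * (B *ᵥ x) i - (B *ᵥ w) i := by
      rw [div_mul_eq_mul_div, div_le_iff₀ (by positivity)]
      linarith [hupp i]
    linarith

/-! ### Products along a digit sequence -/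

lemma Mat_nonneg (c : Fin 4) (r i : Fin 3) : 0 ≤ Mat c r i := by
  fin_cases c <;> fin_cases r <;> fin_cases i <;> simp [Mat, M1, M2, M3, M4]

lemma det_Mat_ne_zero (c : Fin 4) : (Mat c).det ≠ 0 := by
  fin_cases c <;> simp [Mat, M1, M2, M3, M4, det_fin_three]

/-- The product `M_{a n} ⋯ M_{a (n + L - 1)}`. -/
def blockProd (a : ℕ → Fin 4) (n : ℕ) : ℕ → Matrix (Fin 3) (Fin 3) ℝ
  | 0 => 1
  | L + 1 => blockProd a n L * Mat (a (n + L))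

lemma blockProd_mulVec {a : ℕ → Fin 4} {y : ℕ → Fin 3 → ℝ}
    (hy : ∀ n, y n = Mat (a n) *ᵥ y (n + 1)) (n L : ℕ) :
    y n = blockProd a n L *ᵥ y (n + L) := by
  induction L with
  | zero => simp [blockProd]
  | succ L ih => rw [ih, blockProd, ← mulVec_mulVec, ← add_assoc, ← hy]

lemma mulVec_mono {B : Matrix (Fin 3) (Fin 3) ℝ} (hB : ∀ r i, 0 ≤ B r i) {v w : Fin 3 → ℝ}
    (h : ∀ i, v i ≤ w i) (r : Fin 3) : (B *ᵥ v) r ≤ (B *ᵥ w) r :=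
  Finset.sum_le_sum (s := Finset.univ) fun i _ => mul_le_mul_of_nonneg_left (h i) (hB r i)

lemma bracket_of_le {a : ℕ → Fin 4} {w y : ℕ → Fin 3 → ℝ}
    (hy : ∀ n, y n = Mat (a n) *ᵥ y (n + 1)) (hw : ∀ n, w n = Mat (a n) *ᵥ w (n + 1))
    {s : ℝ} {n m : ℕ} (hnm : n ≤ m) (h : ∀ i, s * y m i ≤ w m i) : ∀ i, s * y n i ≤ w n i := by
  induction m, hnm using Nat.le_induction with
  | base => exact h
  | succ m _ ih =>
    refine ih fun i => ?_
    have := mulVec_mono (Mat_nonneg (a m)) (v := s • y (m + 1)) (w := w (m + 1))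
      (by simpa using h) i
    rwa [mulVec_smul, ← hy, ← hw] at this

/-- If blocks with comparable columns occur infinitely often, the nested cones shrink to a ray. -/
lemma eq_smul_of_frequently_comparable {a : ℕ → Fin 4} {w y : ℕ → Fin 3 → ℝ}
    (hy : ∀ n, y n = Mat (a n) *ᵥ y (n + 1)) (hw : ∀ n, w n = Mat (a n) *ᵥ w (n + 1))
    (hy0 : ∀ n i, 0 < y n i) (hw0 : ∀ n i, 0 ≤ w n i)
    (hfreq : ∀ N, ∃ n ≥ N, ∃ L, ComparableColumns (blockProd a n L)) :
    ∃ c : ℝ, 0 ≤ c ∧ w 0 = c • y 0 := by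
  have lower {s : ℝ} {n m : ℕ} (hnm : n ≤ m) := bracket_of_le (s := s) hy hw hnm
  have upper {t : ℝ} {n m : ℕ} (hnm : n ≤ m) (h : ∀ i, w m i ≤ t * y m i) :
      ∀ i, w n i ≤ t * y n i := by
    have hw' (n : ℕ) : (-w) n = Mat (a n) *ᵥ (-w) (n + 1) := by simp [mulVec_neg, ← hw]
    have := bracket_of_le (s := -t) (w := -w) hy hw' hnm (fun i => by simpa using h i)
    exact fun i => by simpa using this i
  have bounded : ∀ n i, w n i ≤ 16 * (w 0 0 / y 0 0) * y n i := by
    intro N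
    obtain ⟨n, hn, L, hB⟩ := hfreq N
    refine upper hn fun i => ?_
    have hY : 0 < ∑ i, y (n + L) i := Finset.sum_pos (fun i _ => hy0 _ i) Finset.univ_nonempty
    set Y := ∑ i, y (n + L) i
    set W := ∑ i, w (n + L) i
    have h1 (i : Fin 3) : W * y n i ≤ 4 * (Y * w n i) := by
      have := hB.mulVec_mul_sum_le (fun i => (hy0 (n + L) i).le) (hw0 (n + L)) i
      rw [← blockProd_mulVec hy, ← blockProd_mulVec hw] at this
      linarith
    have h2 : w n i * Y ≤ 4 * (W * y n i) := by
      have := hB.mulVec_mul_sum_le (hw0 (n + L)) (fun i => (hy0 (n + L) i).le) i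
      rwa [← blockProd_mulVec hy, ← blockProd_mulVec hw] at this
    have h3 := lower (s := W / (4 * Y)) (Nat.zero_le n) (fun i => by
      rw [div_mul_eq_mul_div, div_le_iff₀ (by positivity)]
      linarith [h1 i]) 0
    rw [← le_div_iff₀ (hy0 0 0), div_le_iff₀ (by positivity)] at h3
    have h4 := mul_le_mul_of_nonneg_right h3 (hy0 n i).le
    refine le_of_mul_le_mul_right ?_ hY
    linarith
  have narrow (k : ℕ) : ∀ N, ∃ s t : ℝ, t - s = (3 / 4) ^ k * (16 * (w 0 0 / y 0 0)) ∧
      (∀ i, s * y N i ≤ w N i) ∧ ∀ i, w N i ≤ t * y N i := by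
    induction k with
    | zero => exact fun N => ⟨0, _, by simp, fun i => by simpa using hw0 N i, bounded N⟩
    | succ k ih =>
      intro N
      obtain ⟨n, hn, L, hB⟩ := hfreq N
      obtain ⟨s, t, hst, hs, ht⟩ := ih (n + L)
      obtain ⟨s', t', hst', hs', ht'⟩ := hB.exists_bracket (hy0 _) hs ht
      rw [← blockProd_mulVec hy, ← blockProd_mulVec hw] at hs' ht'
      exact ⟨s', t', by rw [hst', hst]; ring, lower hn hs', upper hn ht'⟩
  have ratio_le (i j : Fin 3) : w 0 i / y 0 i ≤ w 0 j / y 0 j := by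
    have hlim : Filter.Tendsto (fun k : ℕ => (3 / 4 : ℝ) ^ k * (16 * (w 0 0 / y 0 0)))
        Filter.atTop (nhds 0) := by
      simpa using (tendsto_pow_atTop_nhds_zero_of_lt_one (r := (3 / 4 : ℝ)) (by norm_num)
        (by norm_num)).mul_const (16 * (w 0 0 / y 0 0))
    refine sub_nonpos.mp (ge_of_tendsto' hlim fun k => ?_)
    obtain ⟨s, t, hst, hs, ht⟩ := narrow k 0
    have h1 := (div_le_iff₀ (hy0 0 i)).mpr (ht i)
    have h2 := (le_div_iff₀ (hy0 0 j)).mpr (hs j)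
    linarith
  refine ⟨w 0 0 / y 0 0, div_nonneg (hw0 0 0) (hy0 0 0).le, funext fun i => ?_⟩
  rw [le_antisymm (ratio_le 0 i) (ratio_le i 0)]
  exact (div_mul_cancel₀ _ (hy0 0 i).ne').symm

/-! ### Blocks with comparable columns occur infinitely often -/

/-- Inequalities satisfied by all products of `M1`, `M2`, `M3`: the matrix dominates the
identity, and each column is at most the sum of the other two plus a basis vector. -/
structure ColumnBalanced (W : Matrix (Fin 3) (Fin 3) ℝ) : Prop where
  one_le : ∀ r i, (1 : Matrix (Fin 3) (Fin 3) ℝ) r i ≤ W r i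
  col_le : ∀ r i j k, i ≠ j → j ≠ k → k ≠ i →
    W r i ≤ W r j + W r k + (1 : Matrix (Fin 3) (Fin 3) ℝ) r i

lemma one_apply_nonneg (r i : Fin 3) : 0 ≤ (1 : Matrix (Fin 3) (Fin 3) ℝ) r i := by
  rw [one_apply]; split_ifs <;> norm_num

lemma columnBalanced_one : ColumnBalanced 1 :=
  ⟨fun _ _ => le_rfl, fun r i j k _ _ _ => by
    linarith [one_apply_nonneg r j, one_apply_nonneg r k]⟩

lemma ColumnBalanced.nonneg {W : Matrix (Fin 3) (Fin 3) ℝ} (hW : ColumnBalanced W) (r i : Fin 3) :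
    0 ≤ W r i := (one_apply_nonneg r i).trans (hW.one_le r i)

lemma mul_Mat_castSucc (W : Matrix (Fin 3) (Fin 3) ℝ) (c r i : Fin 3) :
    (W * Mat c.castSucc) r i = if i = c then W r c else W r i + W r c := by
  fin_cases c <;> fin_cases i <;>
    simp [Mat, M1, M2, M3, mul_apply, Fin.sum_univ_three] <;> ring

lemma ColumnBalanced.mul_Mat {W : Matrix (Fin 3) (Fin 3) ℝ} (hW : ColumnBalanced W) (c : Fin 3) :
    ColumnBalanced (W * Mat c.castSucc) := by
  refine ⟨fun r i => ?_, fun r i j k hij hjk hki => ?_⟩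
  · rw [mul_Mat_castSucc]
    split_ifs with h
    · exact h ▸ hW.one_le r i
    · linarith [hW.one_le r i, hW.nonneg r c]
  · simp only [mul_Mat_castSucc]
    have := hW.col_le r i j k hij hjk hki
    have := hW.nonneg r j
    have := hW.nonneg r k
    have := hW.nonneg r c
    have := one_apply_nonneg r i
    split_ifs <;> subst_vars <;> first | contradiction | linarith

/-- A balanced block between two occurrences of `M4` has comparable columns. -/
lemma ColumnBalanced.comparableColumns {W : Matrix (Fin 3) (Fin 3) ℝ} (hW : ColumnBalanced W) :
    ComparableColumns (Mat 3 * W * Mat 3) := by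
  have h0 (r i : Fin 3) := hW.one_le r i
  have h1 (r : Fin 3) := hW.col_le r 0 1 2 (by decide) (by decide) (by decide)
  have h2 (r : Fin 3) := hW.col_le r 1 2 0 (by decide) (by decide) (by decide)
  have h3 (r : Fin 3) := hW.col_le r 2 0 1 (by decide) (by decide) (by decide)
  simp only [Fin.forall_fin_succ, Fin.forall_fin_zero, one_apply] at h0 h1 h2 h3
  simp at h0 h1 h2 h3
  intro r i j
  fin_cases r <;> fin_cases i <;> fin_cases j <;>
    simp [Mat, M4, mul_apply, vecMul, dotProduct, Fin.sum_univ_three] <;> linarith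

/-- A balanced block with all entries at least `1` followed by two different digits among
`M1`, `M2`, `M3` has comparable columns. -/
lemma ColumnBalanced.comparableColumns_of_ne {W : Matrix (Fin 3) (Fin 3) ℝ} (hW : ColumnBalanced W)
    (hpos : ∀ r i, 1 ≤ W r i) {c d : Fin 3} (hcd : c ≠ d) :
    ComparableColumns (W * Mat c.castSucc * Mat d.castSucc) := by
  intro r i j
  simp only [mul_Mat_castSucc]
  have h0 (i : Fin 3) := hpos r i
  have h1 := hW.col_le r 0 1 2 (by decide) (by decide) (by decide)
  have h2 := hW.col_le r 1 2 0 (by decide) (by decide) (by decide)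
  have h3 := hW.col_le r 2 0 1 (by decide) (by decide) (by decide)
  have hone (i : Fin 3) : (1 : Matrix (Fin 3) (Fin 3) ℝ) r i ≤ 1 := by
    rw [one_apply]; split_ifs <;> norm_num
  have := hone 0
  have := hone 1
  have := hone 2
  simp only [Fin.forall_fin_succ, Fin.forall_fin_zero] at h0
  simp at h0
  fin_cases c <;> fin_cases d <;> simp at hcd <;> fin_cases i <;> fin_cases j <;>
    simp <;> linarith

lemma exists_castSucc_eq {c : Fin 4} (hc : c ≠ 3) : ∃ d : Fin 3, d.castSucc = c :=
  ⟨c.castPred hc, by simp⟩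

lemma columnBalanced_blockProd {a : ℕ → Fin 4} {n L : ℕ} (h : ∀ l < L, a (n + l) ≠ 3) :
    ColumnBalanced (blockProd a n L) := by
  induction L with
  | zero => exact columnBalanced_one
  | succ L ih =>
    obtain ⟨d, hd⟩ := exists_castSucc_eq (h L L.lt_succ_self)
    rw [blockProd, ← hd]
    exact (ih fun l hl => h l (hl.trans L.lt_succ_self)).mul_Mat d

lemma blockProd_succ' (a : ℕ → Fin 4) (n L : ℕ) :
    blockProd a n (L + 1) = Mat (a n) * blockProd a (n + 1) L := by
  induction L with
  | zero => simp [blockProd]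
  | succ L ih =>
    rw [blockProd, ih, Matrix.mul_assoc, blockProd, show n + (L + 1) = n + 1 + L by ring]

lemma exists_comparable_of_frequently {a : ℕ → Fin 4} (h : ∀ N, ∃ n ≥ N, a n = 3) (N : ℕ) :
    ∃ n ≥ N, ∃ L, ComparableColumns (blockProd a n L) := by
  obtain ⟨n, hn, han⟩ := h N
  have hex : ∃ l, a (n + 1 + l) = 3 := by
    obtain ⟨m, hm, ham⟩ := h (n + 1)
    exact ⟨m - (n + 1), by rwa [Nat.add_sub_cancel' hm]⟩
  classical
  refine ⟨n, hn, Nat.find hex + 2, ?_⟩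
  rw [blockProd_succ', blockProd, han, Nat.find_spec hex, ← Matrix.mul_assoc]
  exact (columnBalanced_blockProd fun l hl => Nat.find_min hex hl).comparableColumns

/-- Without further digit `4`, each of the digits `1`, `2`, `3` occurs again. -/
lemma exists_digit_eq {a : ℕ → Fin 4} {y : ℕ → Fin 3 → ℝ}
    (hy : ∀ n, y n = Mat (a n) *ᵥ y (n + 1)) (hy0 : ∀ n i, 0 < y n i) {N : ℕ}
    (h4 : ∀ n ≥ N, a n ≠ 3) (c : Fin 3) : ∃ n ≥ N, a n = c.castSucc := by
  by_contra! hc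
  have step (n : ℕ) (hn : N ≤ n) :
      y (n + 1) c = y n c ∧ ∑ i, y (n + 1) i ≤ ∑ i, y n i - y n c := by
    obtain ⟨d, hd⟩ := exists_castSucc_eq (h4 n hn)
    have hdc : d ≠ c := fun h => hc n hn (by rw [← hd, h])
    have hyn := hy n
    rw [← hd] at hyn
    have h0 := congrFun hyn 0
    have h1 := congrFun hyn 1
    have h2 := congrFun hyn 2
    have p0 := hy0 (n + 1) 0
    have p1 := hy0 (n + 1) 1
    have p2 := hy0 (n + 1) 2
    rw [Fin.sum_univ_three, Fin.sum_univ_three]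
    fin_cases d <;> fin_cases c <;> simp at hdc <;>
      simp [Mat, M1, M2, M3, mulVec, dotProduct, Fin.sum_univ_three] at h0 h1 h2 ⊢ <;>
      constructor <;> linarith
  have iter (l : ℕ) : y (N + l) c = y N c ∧ ∑ i, y (N + l) i ≤ ∑ i, y N i - l * y N c := by
    induction l with
    | zero => simp
    | succ l ih =>
      obtain ⟨h1, h2⟩ := step (N + l) (Nat.le_add_right _ _)
      refine ⟨h1.trans ih.1, ?_⟩
      rw [← add_assoc]
      push_cast
      linarith [ih.1, ih.2]
  obtain ⟨l, hl⟩ := exists_nat_gt ((∑ i, y N i) / y N c)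
  rw [div_lt_iff₀ (hy0 N c)] at hl
  have : 0 < ∑ i, y (N + l) i := Finset.sum_pos (fun i _ => hy0 _ i) Finset.univ_nonempty
  linarith [(iter l).2]

lemma exists_comparable_of_eventually_ne {a : ℕ → Fin 4} {y : ℕ → Fin 3 → ℝ}
    (hy : ∀ n, y n = Mat (a n) *ᵥ y (n + 1)) (hy0 : ∀ n i, 0 < y n i) {N : ℕ}
    (h4 : ∀ n ≥ N, a n ≠ 3) : ∃ L, ComparableColumns (blockProd a N L) := by
  have hbal (L : ℕ) : ColumnBalanced (blockProd a N L) :=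
    columnBalanced_blockProd fun l _ => h4 _ (Nat.le_add_right _ _)
  have hmono (r i : Fin 3) : Monotone fun L => blockProd a N L r i := by
    refine monotone_nat_of_le_succ fun L => ?_
    obtain ⟨d, hd⟩ := exists_castSucc_eq (h4 (N + L) (Nat.le_add_right _ _))
    rw [blockProd, ← hd, mul_Mat_castSucc]
    split_ifs with h
    · rw [h]
    · linarith [(hbal L).nonneg r d]
  have hrow (r : Fin 3) : ∃ L, ∀ i, 1 ≤ blockProd a N L r i := by
    obtain ⟨n, hn, han⟩ := exists_digit_eq hy hy0 h4 r
    refine ⟨n - N + 1, fun i => ?_⟩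
    rw [blockProd, Nat.add_sub_cancel' hn, han, mul_Mat_castSucc]
    have h1 := (hbal (n - N)).one_le r r
    rw [one_apply_eq] at h1
    split_ifs
    · exact h1
    · linarith [(hbal (n - N)).nonneg r i]
  choose R hR using hrow
  have hpos (L : ℕ) (hL : R 0 + R 1 + R 2 ≤ L) (r i : Fin 3) : 1 ≤ blockProd a N L r i := by
    refine (hR r i).trans (hmono r i (le_trans ?_ hL))
    fin_cases r <;> simp <;> omega
  set L₀ := R 0 + R 1 + R 2
  have hchange : ∃ L ≥ L₀, a (N + L) ≠ a (N + L + 1) := by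
    by_contra! hconst
    have hall (n : ℕ) (hn : N + L₀ ≤ n) : a n = a (N + L₀) := by
      induction n, hn using Nat.le_induction with
      | base => rfl
      | succ n hn ih =>
        rw [← ih]
        obtain ⟨l, rfl⟩ := Nat.exists_eq_add_of_le hn
        rw [add_assoc N]
        exact (hconst (L₀ + l) (Nat.le_add_right _ _)).symm
    have h4' : ∀ n ≥ N + L₀, a n ≠ 3 := fun n hn => h4 n ((Nat.le_add_right _ _).trans hn)
    obtain ⟨n, hn, han⟩ := exists_digit_eq hy hy0 h4' 0
    obtain ⟨m, hm, ham⟩ := exists_digit_eq hy hy0 h4' 1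
    have := (hall n hn).trans (hall m hm).symm
    rw [han, ham] at this
    exact absurd this (by decide)
  obtain ⟨L, hL, hne⟩ := hchange
  obtain ⟨c, hc⟩ := exists_castSucc_eq (h4 (N + L) (Nat.le_add_right _ _))
  obtain ⟨d, hd⟩ := exists_castSucc_eq (h4 (N + L + 1) (by omega))
  refine ⟨L + 2, ?_⟩
  rw [blockProd, blockProd, ← add_assoc, ← hc, ← hd]
  exact (hbal L).comparableColumns_of_ne (hpos L hL) fun h => hne (by rw [← hc, ← hd, h])

lemma frequently_comparable {a : ℕ → Fin 4} {y : ℕ → Fin 3 → ℝ}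
    (hy : ∀ n, y n = Mat (a n) *ᵥ y (n + 1)) (hy0 : ∀ n i, 0 < y n i) (N : ℕ) :
    ∃ n ≥ N, ∃ L, ComparableColumns (blockProd a n L) := by
  by_cases h : ∀ N, ∃ n ≥ N, a n = 3
  · exact exists_comparable_of_frequently h N
  · push Not at h
    obtain ⟨N', hN'⟩ := h
    exact ⟨max N N', le_max_left _ _, exists_comparable_of_eventually_ne hy hy0
      fun n hn => hN' n ((le_max_right _ _).trans hn)⟩

/-! ### Orbits of rationally independent points -/

/-- Points of the simplex whose coordinates are linearly independent over `ℤ`. -/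
structure Irrational3 (x : Fin 3 → ℝ) : Prop where
  mem : x ∈ simplexBar
  indep : ∀ m : Fin 3 → ℤ, (m 0 : ℝ) * x 0 + m 1 * x 1 + m 2 * x 2 = 0 → m = 0

lemma Irrational3.pos {x : Fin 3 → ℝ} (hx : Irrational3 x) (i : Fin 3) : 0 < x i := by
  refine (hx.mem.1 i).lt_of_ne fun h => ?_
  have := congrFun (hx.indep (Pi.single i 1) (by fin_cases i <;> simpa using h.symm)) i
  simp at this

lemma Irrational3.exists_smul {x : Fin 3 → ℝ} (hx : Irrational3 x) :
    ∃ s : ℝ, 0 < s ∧ x = s • (Mat (digit x) *ᵥ fR x) := by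
  have h0 := hx.pos 0
  have h1 := hx.pos 1
  have h2 := hx.pos 2
  unfold digit fR
  split_ifs
  · refine ⟨x 0, h0, funext fun i => ?_⟩
    fin_cases i <;> simp [Mat, M1] <;> field_simp <;> ring
  · refine ⟨x 1, h1, funext fun i => ?_⟩
    fin_cases i <;> simp [Mat, M2] <;> field_simp <;> ring
  · refine ⟨x 2, h2, funext fun i => ?_⟩
    fin_cases i <;> simp [Mat, M3] <;> field_simp <;> ring
  · refine ⟨1 / 2, by norm_num, funext fun i => ?_⟩
    fin_cases i <;> simp [Mat, M4] <;> ring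

lemma Irrational3.fR {x : Fin 3 → ℝ} (hx : Irrational3 x) : Irrational3 (fR x) := by
  have h0 := hx.pos 0
  have h1 := hx.pos 1
  have h2 := hx.pos 2
  have hsum := hx.mem.2
  have key (m : Fin 3 → ℤ) (p q r : ℤ) (h : p * x 0 + q * x 1 + r * x 2 = 0)
      (hm : p = 0 → q = 0 → r = 0 → m 0 = 0 ∧ m 1 = 0 ∧ m 2 = 0) : m = 0 := by
    have := hx.indep ![p, q, r] (by simpa using h)
    have e0 : p = 0 := congrFun this 0
    have e1 : q = 0 := congrFun this 1
    have e2 : r = 0 := congrFun this 2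
    obtain ⟨m0, m1, m2⟩ := hm e0 e1 e2
    funext i
    fin_cases i <;> assumption
  unfold _root_.fR
  split_ifs
  · refine ⟨⟨fun i => ?_, by simp; field_simp; ring⟩, fun m hm => ?_⟩
    · fin_cases i <;> simp <;> apply div_nonneg <;> linarith
    · simp at hm
      field_simp at hm
      refine key m (m 0) (m 1 - m 0) (m 2 - m 0) (by push_cast; linarith) (by omega)
  · refine ⟨⟨fun i => ?_, by simp; field_simp; ring⟩, fun m hm => ?_⟩
    · fin_cases i <;> simp <;> apply div_nonneg <;> linarith
    · simp at hm
      field_simp at hm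
      refine key m (m 0 - m 1) (m 1) (m 2 - m 1) (by push_cast; linarith) (by omega)
  · refine ⟨⟨fun i => ?_, by simp; field_simp; ring⟩, fun m hm => ?_⟩
    · fin_cases i <;> simp <;> apply div_nonneg <;> linarith
    · simp at hm
      field_simp at hm
      refine key m (m 0 - m 2) (m 1 - m 2) (m 2) (by push_cast; linarith) (by omega)
  · refine ⟨⟨fun i => ?_, by simp; linarith⟩, fun m hm => ?_⟩
    · fin_cases i <;> simp <;> linarith
    · simp at hm
      refine key m (-m 0 + m 1 + m 2) (m 0 - m 1 + m 2) (m 0 + m 1 - m 2)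
        (by push_cast; linarith) (by omega)

lemma Irrational3.iterate {x : Fin 3 → ℝ} (hx : Irrational3 x) (n : ℕ) :
    Irrational3 (_root_.fR^[n] x) := by
  induction n with
  | zero => exact hx
  | succ n ih => rw [Function.iterate_succ_apply']; exact ih.fR

lemma Irrational3.exists_orbit {x : Fin 3 → ℝ} (hx : Irrational3 x) :
    ∃ y : ℕ → Fin 3 → ℝ, y 0 = x ∧ (∀ n i, 0 < y n i) ∧
      ∀ n, y n = Mat (digit (_root_.fR^[n] x)) *ᵥ y (n + 1) := by
  choose s hs0 hs using fun n => (hx.iterate n).exists_smul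
  refine ⟨fun n => (∏ k ∈ Finset.range n, s k) • _root_.fR^[n] x, by simp, fun n i => ?_,
    fun n => ?_⟩
  · exact mul_pos (Finset.prod_pos fun k _ => hs0 k) ((hx.iterate n).pos i)
  · rw [mulVec_smul, Finset.prod_range_succ, mul_smul, Function.iterate_succ_apply', ← hs]

lemma prodDigits_eq_blockProd (x : Fin 3 → ℝ) (n : ℕ) :
    prodDigits n x = blockProd (fun k => digit (fR^[k] x)) 0 n := by
  have shift (n k : ℕ) : prodDigits n (fR^[k] x) = blockProd (fun k => digit (fR^[k] x)) k n := by
    induction n generalizing k with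
    | zero => rfl
    | succ n ih => rw [prodDigits, blockProd_succ', ← ih, Function.iterate_succ_apply']
  exact shift n 0

lemma det_blockProd_ne_zero (a : ℕ → Fin 4) (n L : ℕ) : (blockProd a n L).det ≠ 0 := by
  induction L with
  | zero => simp [blockProd]
  | succ L ih => rw [blockProd, det_mul]; exact mul_ne_zero ih (det_Mat_ne_zero _)

lemma Irrational3.iInter_eq_ray {x : Fin 3 → ℝ} (hx : Irrational3 x) :
    (⋂ n : ℕ, (prodDigits n x).mulVec '' {v : Fin 3 → ℝ | ∀ i, 0 ≤ v i})
      = {w : Fin 3 → ℝ | ∃ c : ℝ, 0 ≤ c ∧ w = c • x} := by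
  obtain ⟨y, rfl, hy0, hy⟩ := hx.exists_orbit
  set a : ℕ → Fin 4 := fun k => digit (_root_.fR^[k] (y 0)) with ha
  ext w
  simp only [Set.mem_iInter, prodDigits_eq_blockProd, ← ha]
  constructor
  · intro h
    choose v hv0 hv using h
    replace hv (n : ℕ) : blockProd a 0 n *ᵥ v n = w := hv n
    have hrec (n : ℕ) : v n = Mat (a n) *ᵥ v (n + 1) := by
      refine mulVec_injective_of_isUnit
        ((isUnit_iff_isUnit_det _).mpr (det_blockProd_ne_zero a 0 n).isUnit) ?_
      rw [hv n, mulVec_mulVec, ← hv (n + 1), blockProd, Nat.zero_add]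
    obtain ⟨c, hc, h⟩ :=
      eq_smul_of_frequently_comparable hy hrec hy0 hv0 (frequently_comparable hy hy0)
    exact ⟨c, hc, by simpa [blockProd, ← h] using (hv 0).symm⟩
  · rintro ⟨c, hc, rfl⟩ n
    refine ⟨c • y n, fun i => mul_nonneg hc (hy0 n i).le, ?_⟩
    change blockProd a 0 n *ᵥ (c • y n) = c • y 0
    rw [mulVec_smul, blockProd_mulVec hy 0 n, Nat.zero_add]

/-! ### Almost every point is rationally independent -/

lemma volume_affine_line_eq_zero {α β γ : ℝ} (h : α ≠ 0 ∨ β ≠ 0 ∨ γ ≠ 0) :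
    volume {p : ℝ × ℝ | α + β * p.1 + γ * p.2 = 0} = 0 := by
  have hmeas : MeasurableSet {p : ℝ × ℝ | α + β * p.1 + γ * p.2 = 0} :=
    (isClosed_eq (by fun_prop) continuous_const).measurableSet
  rw [Measure.volume_eq_prod, Measure.measure_prod_null hmeas]
  by_cases hγ : γ = 0
  · have hae : ∀ᵐ s : ℝ, s ≠ -α / β := by simp [ae_iff, measure_singleton]
    filter_upwards [hae] with s hs
    have hne : α + β * s ≠ 0 := by
      intro h0
      by_cases hβ : β = 0
      · subst hβ; simp_all
      · exact hs (by rw [eq_div_iff hβ]; linarith)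
    simp [hγ, hne]
  · refine Filter.Eventually.of_forall fun s => Set.Subsingleton.measure_zero ?_ _
    intro t ht t' ht'
    simp only [Set.mem_preimage, Set.mem_ofPred_eq] at ht ht'
    exact mul_left_cancel₀ hγ (by linarith)

lemma ae_irrational3 : ∀ᵐ x ∂muR, Irrational3 x := by
  have hf : Measurable fun p : ℝ × ℝ => (![1 - p.1 - p.2, p.1, p.2] : Fin 3 → ℝ) :=
    measurable_pi_iff.mpr fun i => by fin_cases i <;> simp <;> fun_prop
  have hac := withDensity_absolutelyContinuous
    ((volume : Measure (ℝ × ℝ)).restrict {p : ℝ × ℝ | 0 < p.1 ∧ 0 < p.2 ∧ p.1 + p.2 < 1})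
    (fun p => ENNReal.ofReal (4 / (Real.pi ^ 2 * (p.1 + p.2) * (1 - p.1) * (1 - p.2))))
  have hmem : ∀ᵐ x ∂muR, x ∈ simplexBar := by
    have hclosed : IsClosed simplexBar := by
      simp only [simplexBar, Set.ofPred_and, Set.ofPred_forall]
      exact (isClosed_iInter fun i => isClosed_le (by fun_prop) (by fun_prop)).inter
        (isClosed_eq (by fun_prop) (by fun_prop))
    refine (ae_map_iff hf.aemeasurable hclosed.measurableSet).mpr (hac.ae_le ?_)
    have htri : MeasurableSet {p : ℝ × ℝ | 0 < p.1 ∧ 0 < p.2 ∧ p.1 + p.2 < 1} := by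
      simp only [Set.ofPred_and]
      exact (measurableSet_lt (by fun_prop) (by fun_prop)).inter
        ((measurableSet_lt (by fun_prop) (by fun_prop)).inter
          (measurableSet_lt (by fun_prop) (by fun_prop)))
    filter_upwards [ae_restrict_mem htri] with p hp
    obtain ⟨h1, h2, h3⟩ := hp
    refine ⟨fun i => ?_, by simp; ring⟩
    fin_cases i <;> simp <;> linarith
  have hindep : ∀ᵐ x ∂muR, ∀ m : Fin 3 → ℤ,
      (m 0 : ℝ) * x 0 + m 1 * x 1 + m 2 * x 2 = 0 → m = 0 := by
    refine ae_all_iff.mpr fun m => ?_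
    by_cases hm : m = 0
    · simp [hm]
    simp only [hm, imp_false]
    have hopen : IsOpen {x : Fin 3 → ℝ | ¬ ((m 0 : ℝ) * x 0 + m 1 * x 1 + m 2 * x 2 = 0)} :=
      isOpen_ne_fun (by fun_prop) (by fun_prop)
    refine (ae_map_iff hf.aemeasurable hopen.measurableSet).mpr
      (hac.ae_le (ae_restrict_of_ae ?_))
    have hcoef : (m 0 : ℝ) ≠ 0 ∨ (m 1 - m 0 : ℝ) ≠ 0 ∨ (m 2 - m 0 : ℝ) ≠ 0 := by
      by_contra! h
      obtain ⟨h0, h1, h2⟩ := h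
      refine hm (funext fun i => ?_)
      have : (m i : ℝ) = 0 := by fin_cases i <;> simp <;> norm_cast at * <;> omega
      exact_mod_cast this
    rw [ae_iff]
    convert volume_affine_line_eq_zero hcoef using 3
    ext p
    simp
    constructor <;> intro h <;> linarith
  filter_upwards [hmem, hindep] with x h1 h2 using ⟨h1, h2⟩

/-- For μ-a.e. x the sequence of digit matrices admits a generalized right eigenvector:
a nonzero nonnegative u with `⋂ₙ M_{a(x)}⋯M_{a(f^{n-1}x)}·ℝ³₊ = ℝ₊·u`.  In particular
the Reverse algorithm is topologically convergent almost everywhere. -/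
theorem reverse_generalized_right_eigenvector :
    ∀ᵐ x ∂muR, ∃ u : Fin 3 → ℝ, u ≠ 0 ∧ (∀ i, 0 ≤ u i) ∧
      (⋂ n : ℕ, (prodDigits n x).mulVec '' {v : Fin 3 → ℝ | ∀ i, 0 ≤ v i})
        = {w : Fin 3 → ℝ | ∃ c : ℝ, 0 ≤ c ∧ w = c • u} := by
  filter_upwards [ae_irrational3] with x hx
  exact ⟨x, fun h => (hx.pos 0).ne' (congrFun h 0), fun i => (hx.pos i).le, hx.iInter_eq_ray⟩

end
end
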